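/- Let P be a combinatorially two-orbit convex d-polytope of class 2_{{0, 1, …, d−2}} with d ≥ 3. Fix a flag Φ = {F_{−1}, F_0, …, F_{d−1}, F_d}, let F′_{d−1} be the facet of Φ^{d−1}, and let γ_0, …, γ_{d−2}, γ′ ∈ Γ(P) be the (unique) automorphisms with γ_i(Φ) = Φ^i for i ≤ d−2 and γ′(Φ) = ((Φ^{d−1})^{d−2})^{d−1}. For 1 ≤ i ≤ d−1 let p_i be the number of faces of rank i strictly between F_{i−2} and F_{i+1}, and let q be the number of faces of rank d−2 strictly between F_{d−4} and F′_{d−1}. Then p_{d−1} is even, and (Γ(P), (γ_0, …, γ_{d−2}, γ′)) is a Coxeter system whose Coxeter matrix M is given by: M(γ_i, γ_i) = M(γ′, γ′) = 1; M(γ_{i−1}, γ_i) = p_i for 1 ≤ i ≤ d−2; M(γ_i, γ_k) = 2 for 0 ≤ i < k ≤ d−2 with k − i ≥ 2; M(γ′, γ_i) = 2 for 0 ≤ i ≤ d−4; M(γ′, γ_{d−3}) = q; and M(γ′, γ_{d−2}) = p_{d−1}/2. -/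

import Mathlib

/-! Generic definitions about flags, flag orbits, and abstract polytopes. -/

variable {α : Type*} [PartialOrder α]

/-- Two flags (maximal chains) are in the same orbit of the automorphism group
(the group of order automorphisms) if some order automorphism maps one onto the other. -/
def SameFlagOrbit (Φ Ψ : Flag α) : Prop :=
  ∃ γ : α ≃o α, γ '' (Φ : Set α) = (Ψ : Set α)

/-- The automorphism group has exactly two orbits on the flags. -/
def TwoFlagOrbits (α : Type*) [PartialOrder α] : Prop :=
  ∃ Φ Ψ : Flag α, ¬ SameFlagOrbit Φ Ψ ∧
    ∀ Ω : Flag α, SameFlagOrbit Ω Φ ∨ SameFlagOrbit Ω Ψ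

/-- `Ψ` is the flag `Φ^i`: it differs from `Φ` in exactly the rank-`i` element
(with respect to the rank function `rk`). -/
def IsIAdjacent (rk : α → ℤ) (i : ℤ) (Φ Ψ : Flag α) : Prop :=
  Φ ≠ Ψ ∧ ∀ x : α, rk x ≠ i → (x ∈ Φ ↔ x ∈ Ψ)

/-- A two-orbit polytope (with rank function `rk`, adjacency indices `0, …, n-1`)
is in class `2_I` if, for every flag `Φ` and every `i < n`, the `i`-adjacent flag `Φ^i`
lies in the same orbit as `Φ` exactly when `i ∈ I`. -/
def InClass (rk : α → ℤ) (n : ℕ) (I : Set ℕ) : Prop :=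
  TwoFlagOrbits α ∧
    ∀ (Φ Ψ : Flag α) (i : ℕ), i < n → IsIAdjacent rk i Φ Ψ →
      (SameFlagOrbit Φ Ψ ↔ i ∈ I)

/-- An abstract polytope of rank `d`: a bounded poset, graded by a rank function `rk`
taking values `-1, 0, …, d`, in which every flag (maximal chain) has exactly one element
of each rank, satisfying the diamond condition and strong flag-connectivity. -/
structure IsAbstractPolytope (α : Type*) [PartialOrder α] [BoundedOrder α]
    (rk : α → ℤ) (d : ℕ) : Prop where
  rk_bot : rk ⊥ = -1
  rk_top : rk ⊤ = d
  rk_strictMono : StrictMono rk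
  rk_cover : ∀ x y : α, x ⋖ y → rk y = rk x + 1
  flag_ranks : ∀ (Φ : Flag α) (i : ℤ), -1 ≤ i → i ≤ d → ∃! x, x ∈ Φ ∧ rk x = i
  diamond : ∀ x y : α, x < y → rk y = rk x + 2 →
    ∃ a b : α, a ≠ b ∧ ∀ z : α, (x < z ∧ z < y) ↔ (z = a ∨ z = b)
  connected : ∀ Φ Ψ : Flag α, ∃ (n : ℕ) (c : Fin (n + 1) → Flag α),
    c 0 = Φ ∧ c (Fin.last n) = Ψ ∧
    (∀ k : Fin n, ∃ i : ℤ, IsIAdjacent rk i (c k.castSucc) (c k.succ)) ∧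
    (∀ k, (Φ : Set α) ∩ (Ψ : Set α) ⊆ (c k : Set α))
/-! Definitions about convex polytopes and their face lattices. -/

/-- Euclidean `d`-space. -/
abbrev EucSp (d : ℕ) : Type := EuclideanSpace ℝ (Fin d)

/-- A convex `d`-polytope: the convex hull of a finite set of points of `ℝ^d`,
with nonempty interior. -/
def IsConvexPolytope {d : ℕ} (P : Set (EucSp d)) : Prop :=
  (∃ S : Finset (EucSp d), P = convexHull ℝ (S : Set (EucSp d))) ∧ (interior P).Nonempty

/-- The face lattice of `P`: the exposed faces of `P` (intersections of `P` with supporting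
hyperplanes, together with `∅` and `P` itself), ordered by inclusion. -/
def Faces {d : ℕ} (P : Set (EucSp d)) : Type := {F : Set (EucSp d) // IsExposed ℝ P F}

noncomputable instance {d : ℕ} (P : Set (EucSp d)) : PartialOrder (Faces P) :=
  Subtype.partialOrder _

open scoped Classical

/-- The rank of a face: `-1` for the empty face, and otherwise its affine dimension. -/
noncomputable def faceRank {d : ℕ} {P : Set (EucSp d)} (F : Faces P) : ℤ :=
  if F.1 = ∅ then -1
  else (Module.finrank ℝ (affineSpan ℝ F.1).direction : ℤ)
/-- The prescribed Coxeter matrix entries for the automorphism group of a facet-intransitive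
two-orbit `d`-polytope, where the generators `γ₀, …, γ_{d-2}` are indexed by `0, …, d-2` and
`γ'` is indexed by `d - 1`. -/
def coxEntry (d : ℕ) (p : ℕ → ℕ) (q : ℕ) (i j : ℕ) : ℕ :=
  if i = j then 1
  else if max i j = d - 1 then
    (if min i j = d - 2 then p (d - 1) / 2 else if min i j = d - 3 then q else 2)
  else if max i j = min i j + 1 then p (max i j)
  else 2

set_option linter.unusedSectionVars false

namespace TwoOrb

section Config
variable {V : Type*} [AddCommGroup V] [Module ℝ V] {L : Type*} [PartialOrder L]

/-- `l` is nonnegative on `S` and vanishes exactly on the subset `t`. -/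
def Exposes (S : Set V) (t : Set V) (l : V →ₗ[ℝ] ℝ) : Prop :=
  (∀ x ∈ S, 0 ≤ l x) ∧ ∀ x, x ∈ t ↔ x ∈ S ∧ l x = 0

/-- A poset realised as the face lattice of a finite pointed vector configuration. -/
structure Cfg (S : Set V) (T : L → Set V) : Prop where
  fin : S.Finite
  pos : ∃ l : V →ₗ[ℝ] ℝ, ∀ x ∈ S, 0 < l x
  le_iff : ∀ a b, a ≤ b ↔ T a ⊆ T b
  exp : ∀ a, ∃ l : V →ₗ[ℝ] ℝ, Exposes S (T a) l
  surj : ∀ l : V →ₗ[ℝ] ℝ, (∀ x ∈ S, 0 ≤ l x) → ∃ a, Exposes S (T a) l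

/-- rank = dimension of the span -/
noncomputable def rkV (T : L → Set V) (a : L) : ℕ :=
  Module.finrank ℝ (Submodule.span ℝ (T a))

variable [FiniteDimensional ℝ V] {S : Set V} {T : L → Set V}

namespace Cfg

lemma sub (h : Cfg S T) (a : L) : T a ⊆ S := by
  obtain ⟨l, hl⟩ := h.exp a
  intro x hx
  exact ((hl.2 x).1 hx).1

lemma inj (h : Cfg S T) {a b : L} (hab : T a = T b) : a = b :=
  le_antisymm ((h.le_iff _ _).2 hab.le) ((h.le_iff _ _).2 hab.ge)

lemma exists_diff (h : Cfg S T) {a b : L} (hab : a < b) : ∃ x ∈ T b, x ∉ T a := by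
  by_contra hc
  push Not at hc
  exact hab.not_ge ((h.le_iff _ _).2 hc)

lemma pos_of {t : Set V} {l : V →ₗ[ℝ] ℝ} (hl : Exposes S t l) {x : V} (hx : x ∈ S)
    (hxt : x ∉ t) : 0 < l x := by
  rcases (hl.1 x hx).lt_or_eq with h | h
  · exact h
  · exact absurd ((hl.2 x).2 ⟨hx, h.symm⟩) hxt

lemma span_le_ker {t : Set V} {f : V →ₗ[ℝ] ℝ} (hf : ∀ x ∈ t, f x = 0) :
    Submodule.span ℝ t ≤ LinearMap.ker f :=
  Submodule.span_le.2 fun x hx => LinearMap.mem_ker.2 (hf x hx)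

lemma mem_of_span (h : Cfg S T) {a : L} {x : V} (hx : x ∈ S)
    (hxs : x ∈ Submodule.span ℝ (T a)) : x ∈ T a := by
  obtain ⟨l, hl⟩ := h.exp a
  refine (hl.2 x).2 ⟨hx, ?_⟩
  exact LinearMap.mem_ker.1 (span_le_ker (fun y hy => ((hl.2 y).1 hy).2) hxs)

lemma smono (h : Cfg S T) {a b : L} (hab : a < b) : rkV T a < rkV T b := by
  apply Submodule.finrank_lt_finrank_of_lt
  refine lt_of_le_of_ne (Submodule.span_mono ((h.le_iff _ _).1 hab.le)) ?_
  intro he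
  obtain ⟨x, hx, hxa⟩ := h.exists_diff hab
  exact hxa (h.mem_of_span (h.sub b hx) (he ▸ Submodule.subset_span hx))

lemma mono (h : Cfg S T) {a b : L} (hab : a ≤ b) : rkV T a ≤ rkV T b := by
  rcases hab.lt_or_eq with h' | h'
  · exact (h.smono h').le
  · rw [h']

lemma eq_of_le_rk (h : Cfg S T) {a b : L} (hab : a ≤ b) (hr : rkV T b ≤ rkV T a) : a = b := by
  by_contra hne
  exact absurd (h.smono (lt_of_le_of_ne hab hne)) (by omega)

/-- face of a face is a face -/
lemma relExp (h : Cfg S T) (b : L) (f : V →ₗ[ℝ] ℝ) (hf : ∀ x ∈ T b, 0 ≤ f x) :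
    ∃ c, ∀ x, x ∈ T c ↔ x ∈ T b ∧ f x = 0 := by
  obtain ⟨l, hl⟩ := h.exp b
  have hN : ∀ᶠ N : ℝ in Filter.atTop, ∀ x ∈ S, 0 < l x → 0 < f x + N * l x := by
    rw [Filter.eventually_all_finite h.fin]
    intro x _
    by_cases hx : 0 < l x
    · have : Filter.Tendsto (fun N : ℝ => f x + N * l x) Filter.atTop Filter.atTop :=
        Filter.tendsto_atTop_add_const_left _ _ (Filter.tendsto_id.atTop_mul_const hx)
      filter_upwards [this.eventually_gt_atTop 0] with N hN _ using hN
    · exact Filter.Eventually.of_forall fun _ h' => absurd h' hx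
  obtain ⟨N, hN⟩ := hN.exists
  have key : ∀ x ∈ S, x ∉ T b → 0 < (f + N • l) x := fun x hx hxb => by
    simpa using hN x hx (pos_of hl hx hxb)
  have key2 : ∀ x ∈ T b, (f + N • l) x = f x := fun x hx => by
    simp [((hl.2 x).1 hx).2]
  obtain ⟨c, hc⟩ := h.surj (f + N • l) (fun x hx => by
    by_cases hxb : x ∈ T b
    · rw [key2 x hxb]; exact hf x hxb
    · exact (key x hx hxb).le)
  refine ⟨c, fun x => ?_⟩
  rw [hc.2]
  constructor
  · rintro ⟨hx, h0⟩
    have hxb : x ∈ T b := by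
      by_contra hxb
      exact (key x hx hxb).ne' h0
    exact ⟨hxb, by rw [← key2 x hxb]; exact h0⟩
  · rintro ⟨hx, h0⟩
    exact ⟨h.sub b hx, by rw [key2 x hx]; exact h0⟩

lemma vanish (h : Cfg S T) {a b : L} (hab : a < b) (hr : rkV T b = rkV T a + 1)
    {f : V →ₗ[ℝ] ℝ} (hf : ∀ x ∈ T a, f x = 0) {g : V} (hg : g ∈ T b) (hga : g ∉ T a)
    (hfg : f g = 0) : ∀ x ∈ T b, f x = 0 := by
  have h1 : Submodule.span ℝ (insert g (T a)) ≤ Submodule.span ℝ (T b) :=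
    Submodule.span_mono (Set.insert_subset hg ((h.le_iff _ _).1 hab.le))
  have h2 : Submodule.span ℝ (T a) < Submodule.span ℝ (insert g (T a)) := by
    refine lt_of_le_of_ne (Submodule.span_mono (Set.subset_insert _ _)) ?_
    intro he
    exact hga (h.mem_of_span (h.sub b hg) (he ▸ Submodule.subset_span (Set.mem_insert _ _)))
  have h3 := Submodule.finrank_lt_finrank_of_lt h2
  have h4 : Submodule.span ℝ (insert g (T a)) = Submodule.span ℝ (T b) := by
    apply Submodule.eq_of_le_of_finrank_le h1
    unfold rkV at hr
    omega
  intro x hx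
  have : x ∈ Submodule.span ℝ (insert g (T a)) := h4 ▸ Submodule.subset_span hx
  refine LinearMap.mem_ker.1 (span_le_ker ?_ this)
  intro y hy
  rcases hy with rfl | hy
  · exact hfg
  · exact hf y hy

lemma prop (h : Cfg S T) {a b : L} (hab : a < b) (hr : rkV T b = rkV T a + 1)
    {f l : V →ₗ[ℝ] ℝ} (hl : Exposes S (T a) l) (hf : ∀ x ∈ T a, f x = 0) :
    ∃ c : ℝ, ∀ x ∈ T b, f x = c * l x := by
  obtain ⟨g, hg, hga⟩ := h.exists_diff hab
  have hp := pos_of hl (h.sub b hg) hga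
  refine ⟨f g / l g, fun x hx => ?_⟩
  have := h.vanish hab hr (f := f - (f g / l g) • l) (fun y hy => by
    simp [hf y hy, ((hl.2 y).1 hy).2]) hg hga (by simp; field_simp; simp) x hx
  simpa [sub_eq_zero] using this

/-- rotating a supporting hyperplane until it hits a new element -/
lemma pencil (h : Cfg S T) {a b : L} (hab : a < b) {l : V →ₗ[ℝ] ℝ} (hl : Exposes S (T a) l)
    {f : V →ₗ[ℝ] ℝ} (hf : ∀ x ∈ T a, f x = 0) :
    ∃ (t : ℝ) (c : L), (∀ x ∈ T b, t * l x ≤ f x) ∧ (∀ x, x ∈ T c ↔ x ∈ T b ∧ f x = t * l x) ∧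
      a < c ∧ c ≤ b := by
  have hfin : (T b \ T a).Finite := h.fin.subset (Set.sdiff_subset.trans (h.sub b))
  obtain ⟨g0, hg0⟩ := h.exists_diff hab
  obtain ⟨g, hg, hmin⟩ := Set.exists_min_image (T b \ T a) (fun x => f x / l x) hfin ⟨g0, hg0⟩
  have hle : ∀ x ∈ T b, f g / l g * l x ≤ f x := by
    intro x hx
    by_cases hxa : x ∈ T a
    · simp [hf x hxa, ((hl.2 x).1 hxa).2]
    · have hp := pos_of hl (h.sub b hx) hxa
      have := hmin x ⟨hx, hxa⟩
      exact (le_div_iff₀ hp).1 this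
  obtain ⟨c, hc⟩ := h.relExp b (f - (f g / l g) • l) (fun x hx => by
    simpa using hle x hx)
  have hc' : ∀ x, x ∈ T c ↔ x ∈ T b ∧ f x = f g / l g * l x := fun x => by
    rw [hc]; simp [sub_eq_zero]
  refine ⟨f g / l g, c, hle, hc', ?_, ?_⟩
  · refine lt_of_le_of_ne ((h.le_iff _ _).2 fun x hx => ?_) ?_
    · exact (hc' x).2 ⟨(h.le_iff _ _).1 hab.le hx, by simp [hf x hx, ((hl.2 x).1 hx).2]⟩
    · rintro rfl
      have hp := pos_of hl (h.sub b hg.1) hg.2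
      exact hg.2 ((hc' g).2 ⟨hg.1, by field_simp⟩)
  · exact (h.le_iff _ _).2 fun x hx => ((hc' x).1 hx).1

lemma exists_indep (h : Cfg S T) {a b : L} (hab : a < b) (hr : rkV T a + 2 ≤ rkV T b) :
    ∃ f : V →ₗ[ℝ] ℝ, (∀ x ∈ T a, f x = 0) ∧ ∃ g ∈ T b, g ∉ T a ∧ f g = 0 ∧ ∃ y ∈ T b, f y ≠ 0 := by
  obtain ⟨g, hg, hga⟩ := h.exists_diff hab
  have : ∃ y ∈ T b, y ∉ Submodule.span ℝ (insert g (T a)) := by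
    by_contra hc
    push Not at hc
    have h1 : Submodule.span ℝ (T b) ≤ Submodule.span ℝ (insert g (T a)) := Submodule.span_le.2 hc
    have h2 := Submodule.finrank_mono h1
    have h3 : Module.finrank ℝ (Submodule.span ℝ (insert g (T a))) ≤ rkV T a + 1 := by
      rw [Submodule.span_insert]
      have h5 := Submodule.finrank_add_le_finrank_add_finrank (Submodule.span ℝ {g}) (Submodule.span ℝ (T a))
      have h6 : Module.finrank ℝ (Submodule.span ℝ {g}) ≤ 1 := by
        simpa using finrank_span_le_card (R := ℝ) ({g} : Set V)
      unfold rkV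
      omega
    unfold rkV at *
    omega
  obtain ⟨y, hy, hys⟩ := this
  obtain ⟨f, hf1, hf2⟩ := Submodule.exists_le_ker_of_notMem hys
  refine ⟨f, fun x hx => ?_, g, hg, hga, ?_, y, hy, hf1⟩
  · exact LinearMap.mem_ker.1 (hf2 (Submodule.subset_span (Set.mem_insert_of_mem _ hx)))
  · exact LinearMap.mem_ker.1 (hf2 (Submodule.subset_span (Set.mem_insert _ _)))

lemma dense (h : Cfg S T) {a b : L} (hab : a < b) (hr : rkV T a + 2 ≤ rkV T b) :
    ∃ c, a < c ∧ c < b := by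
  obtain ⟨f, hf, g, hg, hga, hfg, y, hy, hfy⟩ := h.exists_indep hab hr
  obtain ⟨l, hl⟩ := h.exp a
  obtain ⟨t, c, h1, h2, h3, h4⟩ := h.pencil hab hl hf
  refine ⟨c, h3, lt_of_le_of_ne h4 ?_⟩
  rintro rfl
  have e1 := ((h2 g).1 hg).2
  have e2 := ((h2 y).1 hy).2
  have hp := pos_of hl (h.sub _ hg) hga
  rw [hfg] at e1
  have : t = 0 := by
    rcases mul_eq_zero.1 e1.symm with h | h
    · exact h
    · exact absurd h hp.ne'
  rw [this] at e2
  exact hfy (by simpa using e2)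

lemma diamond (h : Cfg S T) {a b : L} (hab : a < b) (hr : rkV T b = rkV T a + 2) :
    ∃ c c' : L, c ≠ c' ∧ ∀ z, (a < z ∧ z < b) ↔ (z = c ∨ z = c') := by
  obtain ⟨f, hf, g, hg, hga, hfg, y, hy, hfy⟩ := h.exists_indep hab hr.ge
  obtain ⟨l, hl⟩ := h.exp a
  have hnp : ∀ t : ℝ, ¬ ∀ x ∈ T b, f x = t * l x := by
    intro t ht
    have e1 := ht g hg
    have e2 := ht y hy
    have hp := pos_of hl (h.sub _ hg) hga
    rw [hfg] at e1
    have : t = 0 := by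
      rcases mul_eq_zero.1 e1.symm with h | h
      · exact h
      · exact absurd h hp.ne'
    rw [this] at e2
    exact hfy (by simpa using e2)
  obtain ⟨t, c, h1, h2, h3, h4⟩ := h.pencil hab hl hf
  obtain ⟨t', c', h1', h2', h3', h4'⟩ := h.pencil hab hl (f := -f) (fun x hx => by simp [hf x hx])
  have hcb : c < b := lt_of_le_of_ne h4 (by
    rintro rfl
    exact hnp t fun x hx => ((h2 x).1 hx).2)
  have hcb' : c' < b := lt_of_le_of_ne h4' (by
    rintro rfl
    exact hnp (-t') fun x hx => by
      have := ((h2' x).1 hx).2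
      simp only [LinearMap.neg_apply] at this
      linarith)
  simp only [LinearMap.neg_apply] at h1' h2'
  obtain ⟨u, hu, hua⟩ := h.exists_diff h3
  obtain ⟨u', hu', hua'⟩ := h.exists_diff h3'
  have pu := pos_of hl (h.sub _ hu) hua
  have pu' := pos_of hl (h.sub _ hu') hua'
  obtain ⟨hub, hu2⟩ := (h2 u).1 hu
  obtain ⟨hub', hu2'⟩ := (h2' u').1 hu'
  refine ⟨c, c', ?_, fun z => ⟨?_, ?_⟩⟩
  · rintro rfl
    have := ((h2' u).1 hu).2
    have htt : t' = -t := by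
      have : (t' + t) * l u = 0 := by linarith
      rcases mul_eq_zero.1 this with h | h
      · linarith
      · exact absurd h pu.ne'
    subst htt
    exact hnp t fun x hx => le_antisymm (by linarith [h1' x hx]) (h1 x hx)
  · rintro ⟨haz, hzb⟩
    have r1 := h.smono haz
    have r2 := h.smono hzb
    obtain ⟨e, he⟩ := h.prop haz (by omega) hl hf
    obtain ⟨m, hm⟩ := h.exp z
    obtain ⟨k, hk⟩ := h.prop hzb (by omega) (f := f - e • l) hm (fun x hx => by simp [he x hx])
    simp only [LinearMap.sub_apply, LinearMap.smul_apply, smul_eq_mul] at hk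
    obtain ⟨w, hw, hwa⟩ := h.exists_diff haz
    have hwb := (h.le_iff _ _).1 hzb.le hw
    have pw := pos_of hl (h.sub _ hw) hwa
    have hew := he w hw
    rcases lt_trichotomy k 0 with hk0 | hk0 | hk0
    · right
      have hle : ∀ x ∈ T b, f x ≤ e * l x := fun x hx => by
        have := hk x hx
        nlinarith [hm.1 x (h.sub _ hx)]
      have e1 : e = -t' := by
        apply le_antisymm
        · have := h1' w hwb
          by_contra hc
          push Not at hc
          nlinarith
        · have := hle u' hub'
          by_contra hc
          push Not at hc
          nlinarith
      apply h.inj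
      ext x
      rw [h2' x]
      constructor
      · intro hx
        exact ⟨(h.le_iff _ _).1 hzb.le hx, by rw [he x hx, e1]; ring⟩
      · rintro ⟨hx, hx2⟩
        refine (hm.2 x).2 ⟨h.sub _ hx, ?_⟩
        have := hk x hx
        rw [e1] at this
        have : k * m x = 0 := by linarith
        exact (mul_eq_zero.1 this).resolve_left hk0.ne
    · exact absurd (fun x hx => by have := hk x hx; rw [hk0] at this; linarith) (hnp e)
    · left
      have hle : ∀ x ∈ T b, e * l x ≤ f x := fun x hx => by
        have := hk x hx
        nlinarith [hm.1 x (h.sub _ hx)]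
      have e1 : e = t := by
        apply le_antisymm
        · have := hle u hub
          by_contra hc
          push Not at hc
          nlinarith
        · have := h1 w hwb
          by_contra hc
          push Not at hc
          nlinarith
      apply h.inj
      ext x
      rw [h2 x]
      constructor
      · intro hx
        exact ⟨(h.le_iff _ _).1 hzb.le hx, by rw [he x hx, e1]⟩
      · rintro ⟨hx, hx2⟩
        refine (hm.2 x).2 ⟨h.sub _ hx, ?_⟩
        have := hk x hx
        rw [e1] at this
        have : k * m x = 0 := by linarith
        exact (mul_eq_zero.1 this).resolve_left hk0.ne'
  · rintro (rfl | rfl)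
    · exact ⟨h3, hcb⟩
    · exact ⟨h3', hcb'⟩

lemma meet (h : Cfg S T) (a b : L) : ∃ c, T c = T a ∩ T b := by
  obtain ⟨l, hl⟩ := h.exp a
  obtain ⟨c, hc⟩ := h.relExp b l (fun x hx => hl.1 x (h.sub _ hx))
  refine ⟨c, ?_⟩
  ext x
  rw [hc, Set.mem_inter_iff, hl.2]
  have : x ∈ T b → x ∈ S := fun hx => h.sub b hx
  tauto

lemma lat (h : Cfg S T) {a b e e' : L} {k : ℕ} (hab : a ≠ b) (ha : rkV T a = k)
    (hb : rkV T b = k) (he : rkV T e = k + 1) (he' : rkV T e' = k + 1)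
    (h1 : a ≤ e) (h2 : b ≤ e) (h3 : a ≤ e') (h4 : b ≤ e') : e = e' := by
  obtain ⟨c, hc⟩ := h.meet e e'
  have hac : a ≤ c := (h.le_iff _ _).2 (hc ▸ Set.subset_inter ((h.le_iff _ _).1 h1) ((h.le_iff _ _).1 h3))
  have hbc : b ≤ c := (h.le_iff _ _).2 (hc ▸ Set.subset_inter ((h.le_iff _ _).1 h2) ((h.le_iff _ _).1 h4))
  have hlt : a < c := lt_of_le_of_ne hac (by
    rintro rfl
    exact hab (h.eq_of_le_rk hbc (by omega)).symm)
  have := h.smono hlt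
  have hce : c ≤ e := (h.le_iff _ _).2 (hc ▸ Set.inter_subset_left)
  have hce' : c ≤ e' := (h.le_iff _ _).2 (hc ▸ Set.inter_subset_right)
  rw [← h.eq_of_le_rk hce (by omega), ← h.eq_of_le_rk hce' (by omega)]

lemma finite (h : Cfg S T) : Finite L := by
  have : Finite (𝒫 S) := h.fin.finite_subsets
  exact Finite.of_injective (fun a => (⟨T a, h.sub a⟩ : 𝒫 S)) fun a b hab =>
    h.inj (congrArg Subtype.val hab)

lemma bot (h : Cfg S T) : ∃ b : L, rkV T b = 0 ∧ ∀ x, b ≤ x := by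
  obtain ⟨l, hl⟩ := h.pos
  obtain ⟨b, hb⟩ := h.surj l (fun x hx => (hl x hx).le)
  have : T b = ∅ := by
    ext x
    rw [hb.2]
    simp only [Set.mem_empty_iff_false, iff_false, not_and]
    exact fun hx => (hl x hx).ne'
  refine ⟨b, ?_, fun x => ?_⟩
  · simp [rkV, this]
  · rw [h.le_iff, this]; exact Set.empty_subset _

lemma top (h : Cfg S T) : ∃ b : L, rkV T b = Module.finrank ℝ (Submodule.span ℝ S) ∧ ∀ x, x ≤ b := by
  obtain ⟨b, hb⟩ := h.surj 0 (fun x hx => by simp)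
  have : T b = S := by
    ext x
    rw [hb.2]
    simp
  refine ⟨b, by rw [rkV, this], fun x => ?_⟩
  rw [h.le_iff, this]; exact h.sub x

lemma empty_of_rk (h : Cfg S T) {a : L} (ha : rkV T a = 0) : T a = ∅ := by
  obtain ⟨l, hl⟩ := h.pos
  unfold rkV at ha
  rw [Submodule.finrank_eq_zero, Submodule.span_eq_bot] at ha
  ext x
  simp only [Set.mem_empty_iff_false, iff_false]
  intro hx
  have := hl x (h.sub _ hx)
  rw [ha x hx] at this
  simp at this

end Cfg
end Config
end TwoOrb
set_option linter.unusedSectionVars false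

namespace TwoOrb

section Morse
variable {V : Type*} [AddCommGroup V] [Module ℝ V] {L : Type*} [PartialOrder L]
variable [FiniteDimensional ℝ V] {S : Set V} {T : L → Set V}

lemma eventually_ne_lin (u w : ℝ) (h : u ≠ 0 ∨ w ≠ 0) :
    ∀ᶠ e : ℝ in Filter.atTop, u + e * w ≠ 0 := by
  by_cases hw : w = 0
  · subst hw
    have hu : u ≠ 0 := by simpa using h
    exact Filter.Eventually.of_forall fun e => by simpa using hu
  · filter_upwards [Filter.eventually_ne_atTop (-u / w)] with e he h0
    apply he
    field_simp
    linarith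

namespace Cfg

lemma genexp_aux (h : Cfg S T) (a : L) (f : V →ₗ[ℝ] ℝ) (K : Finset (V × V))
    (hK : ∀ z ∈ K, ∃ p : V →ₗ[ℝ] ℝ, (∀ x ∈ S, 0 ≤ p x) ∧ (∀ x ∈ T a, p x = 0) ∧
      f z.1 * p z.2 - f z.2 * p z.1 ≠ 0) :
    ∃ l, Exposes S (T a) l ∧ ∀ z ∈ K, f z.1 * l z.2 - f z.2 * l z.1 ≠ 0 := by
  induction K using Finset.induction_on with
  | empty =>
    obtain ⟨l, hl⟩ := h.exp a
    exact ⟨l, hl, by simp⟩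
  | insert z K _ ih =>
    obtain ⟨l, hl, hlK⟩ := ih fun y hy => hK y (Finset.mem_insert_of_mem hy)
    obtain ⟨p, hp1, hp2, hp3⟩ := hK z (Finset.mem_insert_self _ _)
    have hev : ∀ᶠ e : ℝ in Filter.atTop, ∀ y ∈ (insert z K : Finset (V × V)),
        (f y.1 * l y.2 - f y.2 * l y.1) + e * (f y.1 * p y.2 - f y.2 * p y.1) ≠ 0 := by
      rw [Filter.eventually_all_finset]
      intro y hy
      apply eventually_ne_lin
      rcases Finset.mem_insert.1 hy with rfl | hy
      · exact Or.inr hp3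
      · exact Or.inl (hlK y hy)
    obtain ⟨e, he, he0⟩ := (hev.and (Filter.eventually_ge_atTop 0)).exists
    refine ⟨l + e • p, ⟨fun x hx => ?_, fun x => ?_⟩, fun y hy => ?_⟩
    · have := hl.1 x hx
      have := mul_nonneg he0 (hp1 x hx)
      simp; linarith
    · constructor
      · intro hx
        have := (hl.2 x).1 hx
        simp [this, hp2 x hx]
      · rintro ⟨hx, h0⟩
        refine (hl.2 x).2 ⟨hx, ?_⟩
        have := hl.1 x hx
        have := mul_nonneg he0 (hp1 x hx)
        simp at h0
        linarith
    · have := he y hy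
      intro h0
      apply this
      simp at h0
      linarith

end Cfg

/-- `l` exposes `a`, and the quotient `f / l` separates the covers of `a`. -/
def Good (S : Set V) (T : L → Set V) (a : L) (f l : V →ₗ[ℝ] ℝ) : Prop :=
  Exposes S (T a) l ∧ ∀ b b', a < b → a < b' → rkV T b = rkV T a + 1 → rkV T b' = rkV T a + 1 →
    b ≠ b' → ∀ x ∈ T b, x ∉ T a → ∀ x' ∈ T b', x' ∉ T a → f x * l x' ≠ f x' * l x

/-- `f` vanishes on `a` and on no cover of `a`. -/
def Inv (T : L → Set V) (a : L) (f : V →ₗ[ℝ] ℝ) : Prop :=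
  (∀ x ∈ T a, f x = 0) ∧ ∀ b, a < b → rkV T b = rkV T a + 1 → ∀ x ∈ T b, x ∉ T a → f x ≠ 0

lemma Cfg.genexp (h : Cfg S T) (a : L) (f : V →ₗ[ℝ] ℝ) (hf : Inv T a f) :
    ∃ l, Good S T a f l := by
  let K : Set (V × V) := {z | z.1 ∈ S ∧ z.2 ∈ S ∧ ∃ p : V →ₗ[ℝ] ℝ, (∀ x ∈ S, 0 ≤ p x) ∧
      (∀ x ∈ T a, p x = 0) ∧ f z.1 * p z.2 - f z.2 * p z.1 ≠ 0}
  have hKf : K.Finite := (h.fin.prod h.fin).subset fun z hz => ⟨hz.1, hz.2.1⟩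
  obtain ⟨l, hl, hl2⟩ := h.genexp_aux a f hKf.toFinset (fun z hz => by
    rw [Set.Finite.mem_toFinset] at hz
    exact hz.2.2)
  refine ⟨l, hl, fun b b' hb hb' rb rb' hne x hx hxa x' hx' hxa' he => ?_⟩
  refine hl2 (x, x') ?_ (sub_eq_zero.2 he)
  rw [Set.Finite.mem_toFinset]
  refine ⟨h.sub _ hx, h.sub _ hx', ?_⟩
  obtain ⟨p, hp⟩ := h.exp b
  refine ⟨p, hp.1, fun y hy => ((hp.2 y).1 ((h.le_iff _ _).1 hb.le hy)).2, ?_⟩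
  have hx'b : x' ∉ T b := by
    intro hxb
    obtain ⟨c, hc⟩ := h.meet b b'
    have hac : a < c := by
      refine lt_of_le_of_ne ((h.le_iff _ _).2 ?_) ?_
      · rw [hc]; exact Set.subset_inter ((h.le_iff _ _).1 hb.le) ((h.le_iff _ _).1 hb'.le)
      · rintro rfl
        exact hxa' (hc ▸ ⟨hxb, hx'⟩)
    have := h.smono hac
    have e1 := h.eq_of_le_rk ((h.le_iff c b).2 (hc ▸ Set.inter_subset_left)) (by omega)
    have e2 := h.eq_of_le_rk ((h.le_iff c b').2 (hc ▸ Set.inter_subset_right)) (by omega)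
    exact hne (e1.symm.trans e2)
  have h1 := Cfg.pos_of hp (h.sub _ hx') hx'b
  simp only [((hp.2 x).1 hx).2, mul_zero, sub_zero]
  exact mul_ne_zero (hf.2 b hb rb x hx hxa) h1.ne'

/-- chosen generic exposing functional -/
noncomputable def exF (S : Set V) (T : L → Set V) (a : L) (f : V →ₗ[ℝ] ℝ) : V →ₗ[ℝ] ℝ :=
  if h : ∃ l, Good S T a f l then Classical.choose h else 0

/-- chosen proportionality factor -/
noncomputable def coef (t : Set V) (f l : V →ₗ[ℝ] ℝ) : ℝ :=
  if h : ∃ c : ℝ, ∀ x ∈ t, f x = c * l x then Classical.choose h else 0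

/-- the sequence of functionals attached to a flag -/
noncomputable def seqA (S : Set V) (T : L → Set V) (a0 : V →ₗ[ℝ] ℝ) (v : ℕ → L) : ℕ → V →ₗ[ℝ] ℝ
  | 0 => a0
  | k + 1 => seqA S T a0 v k -
      coef (T (v (k + 1))) (seqA S T a0 v k) (exF S T (v k) (seqA S T a0 v k)) •
        exF S T (v k) (seqA S T a0 v k)

/-- the heights attached to a flag -/
noncomputable def seqC (S : Set V) (T : L → Set V) (a0 : V →ₗ[ℝ] ℝ) (v : ℕ → L) (k : ℕ) : ℝ :=
  coef (T (v (k + 1))) (seqA S T a0 v k) (exF S T (v k) (seqA S T a0 v k))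

/-- `v 0 < v 1 < ... < v n` with `v k` of rank `k` -/
def IsSeq (rk : L → ℕ) (n : ℕ) (v : ℕ → L) : Prop :=
  (∀ k ≤ n, rk (v k) = k) ∧ ∀ k < n, v k < v (k + 1)

lemma IsSeq.le {rk : L → ℕ} {n : ℕ} {v : ℕ → L} (hv : IsSeq rk n v) {i j : ℕ} (hij : i ≤ j)
    (hj : j ≤ n) : v i ≤ v j := by
  induction j, hij using Nat.le_induction with
  | base => exact le_rfl
  | succ j hij ih => exact (ih (by omega)).trans (hv.2 j (by omega)).le

lemma seqA_congr {a0 : V →ₗ[ℝ] ℝ} {v w : ℕ → L} {k : ℕ} (h : ∀ j ≤ k, v j = w j) :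
    seqA S T a0 v k = seqA S T a0 w k := by
  induction k with
  | zero => rfl
  | succ k ih =>
    have e := ih fun j hj => h j (by omega)
    simp only [seqA]
    rw [e, h k (by omega), h (k + 1) le_rfl]

lemma seqC_congr {a0 : V →ₗ[ℝ] ℝ} {v w : ℕ → L} {k : ℕ} (h : ∀ j ≤ k + 1, v j = w j) :
    seqC S T a0 v k = seqC S T a0 w k := by
  have e : seqA S T a0 v k = seqA S T a0 w k := seqA_congr fun j hj => h j (by omega)
  simp only [seqC]
  rw [e, h k (by omega), h (k + 1) le_rfl]

lemma Cfg.good (h : Cfg S T) {a : L} {f : V →ₗ[ℝ] ℝ} (hf : Inv T a f) :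
    Good S T a f (exF S T a f) := by
  have := h.genexp a f hf
  rw [exF, dif_pos this]
  exact Classical.choose_spec this

lemma Cfg.coef_spec (h : Cfg S T) {a b : L} {f : V →ₗ[ℝ] ℝ} (hf : Inv T a f) (hab : a < b)
    (hr : rkV T b = rkV T a + 1) :
    ∀ x ∈ T b, f x = coef (T b) f (exF S T a f) * exF S T a f x := by
  have := h.prop hab hr (h.good hf).1 hf.1
  rw [coef, dif_pos this]
  exact Classical.choose_spec this

lemma Cfg.coef_ne (h : Cfg S T) {a b b' : L} {f : V →ₗ[ℝ] ℝ} (hf : Inv T a f) (hab : a < b)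
    (hr : rkV T b = rkV T a + 1) (hab' : a < b') (hr' : rkV T b' = rkV T a + 1) (hne : b ≠ b') :
    coef (T b) f (exF S T a f) ≠ coef (T b') f (exF S T a f) := by
  intro he
  obtain ⟨x, hx, hxa⟩ := h.exists_diff hab
  obtain ⟨x', hx', hxa'⟩ := h.exists_diff hab'
  apply (h.good hf).2 b b' hab hab' hr hr' hne x hx hxa x' hx' hxa'
  rw [h.coef_spec hf hab hr x hx, h.coef_spec hf hab' hr' x' hx', he]
  ring

lemma Cfg.inv_step (h : Cfg S T) {a b : L} {f : V →ₗ[ℝ] ℝ} (hf : Inv T a f) (hab : a < b)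
    (hr : rkV T b = rkV T a + 1) :
    Inv T b (f - coef (T b) f (exF S T a f) • exF S T a f) := by
  set l := exF S T a f with hl
  set c := coef (T b) f l with hc
  have hv : ∀ x ∈ T b, (f - c • l) x = 0 := fun x hx => by
    have := h.coef_spec hf hab hr x hx
    simp [this, hc, hl]
  refine ⟨hv, fun e hbe hre x hx hxb => ?_⟩
  obtain ⟨y1, y2, hy12, hy⟩ := h.diamond (hab.trans hbe) (by omega)
  have : ∃ y, y ≠ b ∧ a < y ∧ y < e := by
    by_cases hy1 : y1 = b
    · exact ⟨y2, fun h => hy12 (hy1.trans h.symm), (hy y2).2 (Or.inr rfl)⟩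
    · exact ⟨y1, hy1, (hy y1).2 (Or.inl rfl)⟩
  obtain ⟨y, hyb, hay, hye⟩ := this
  have r1 := h.smono hay
  have r2 := h.smono hye
  have hry : rkV T y = rkV T a + 1 := by omega
  obtain ⟨g, hg, hga⟩ := h.exists_diff hay
  have hlg := Cfg.pos_of (h.good hf).1 (h.sub _ hg) hga
  have hg0 : (f - c • l) g ≠ 0 := by
    have e1 := h.coef_spec hf hay hry g hg
    have e2 := h.coef_ne hf hay hry hab hr hyb
    simp only [LinearMap.sub_apply, LinearMap.smul_apply, smul_eq_mul]
    rw [e1, ← sub_mul]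
    exact mul_ne_zero (sub_ne_zero.2 e2) hlg.ne'
  obtain ⟨m, hm⟩ := h.exp b
  obtain ⟨k, hk⟩ := h.prop hbe hre hm hv
  have hk0 : k ≠ 0 := by
    rintro rfl
    apply hg0
    rw [hk g ((h.le_iff _ _).1 hye.le hg)]
    simp
  rw [hk x hx]
  exact mul_ne_zero hk0 (Cfg.pos_of hm (h.sub _ hx) hxb).ne'

variable {n : ℕ} {a0 : V →ₗ[ℝ] ℝ} {v w u : ℕ → L}

lemma Cfg.inv (h : Cfg S T) (ha0 : ∀ x ∈ S, 0 < a0 x) (hv : IsSeq (rkV T) n v) {k : ℕ}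
    (hk : k ≤ n) : Inv T (v k) (seqA S T a0 v k) := by
  induction k with
  | zero =>
    have h0 := h.empty_of_rk (hv.1 0 hk)
    refine ⟨by simp [h0], fun b _ _ x hx _ => (ha0 x (h.sub _ hx)).ne'⟩
  | succ k ih =>
    have h1 := hv.1 k (by omega)
    have h2 := hv.1 (k + 1) hk
    exact h.inv_step (ih (by omega)) (hv.2 k hk) (by omega)

lemma Cfg.seqC_ne (h : Cfg S T) (ha0 : ∀ x ∈ S, 0 < a0 x) (hv : IsSeq (rkV T) n v)
    (hw : IsSeq (rkV T) n w) {k : ℕ} (hk : k < n) (hvw : ∀ j ≤ k, v j = w j)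
    (hne : v (k + 1) ≠ w (k + 1)) : seqC S T a0 v k ≠ seqC S T a0 w k := by
  have e := seqA_congr (S := S) (T := T) (a0 := a0) hvw
  have h1 := hv.1 k hk.le
  have h2 := hv.1 (k + 1) hk
  have h3 := hw.1 (k + 1) hk
  have h4 := hw.2 k hk
  rw [← hvw k le_rfl] at h4
  unfold seqC
  rw [← e, ← hvw k le_rfl]
  exact h.coef_ne (h.inv ha0 hv hk.le) (hv.2 k hk) (by omega) h4 (by omega) hne

/-- If replacing `v (k+1)` makes the flag lower, the next height is negative. -/
lemma Cfg.neg (h : Cfg S T) (ha0 : ∀ x ∈ S, 0 < a0 x) (hv : IsSeq (rkV T) n v)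
    (hu : IsSeq (rkV T) n u) {k : ℕ} (hk : k + 1 < n) (huv : ∀ j ≤ n, j ≠ k + 1 → u j = v j)
    (hlt : seqC S T a0 u k < seqC S T a0 v k) : seqC S T a0 v (k + 1) < 0 := by
  have e : seqA S T a0 u k = seqA S T a0 v k := seqA_congr fun j hj => huv j (by omega) (by omega)
  have i1 := h.inv ha0 hv (k := k) (by omega)
  have i2 := h.inv ha0 hv (k := k + 1) (by omega)
  have h1 := hv.1 k (by omega)
  have h2 := hv.1 (k + 1) (by omega)
  have h3 := hu.1 (k + 1) (by omega)
  have h4 := hv.1 (k + 1 + 1) (by omega)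
  have ek := huv k (by omega) (by omega)
  have l1 : v k < u (k + 1) := by rw [← ek]; exact hu.2 k (by omega)
  have l2 : u (k + 1) < v (k + 2) := by
    rw [← huv (k + 2) (by omega) (by omega)]; exact hu.2 (k + 1) (by omega)
  obtain ⟨g, hg, hga⟩ := h.exists_diff l1
  have hlg := Cfg.pos_of (h.good i1).1 (h.sub _ hg) hga
  have e1 := h.coef_spec i1 l1 (by omega) g hg
  have e2 := h.coef_spec i2 (hv.2 (k + 1) (by omega)) (by omega) g ((h.le_iff _ _).1 l2.le hg)
  have e3 : seqA S T a0 v (k + 1) g = (seqC S T a0 u k - seqC S T a0 v k) *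
      exF S T (v k) (seqA S T a0 v k) g := by
    simp only [seqA, LinearMap.sub_apply, LinearMap.smul_apply, smul_eq_mul, seqC]
    rw [e, ek, ← e1.symm.trans rfl]
    rw [sub_mul, ← e1]
  have hneg : seqA S T a0 v (k + 1) g < 0 := by
    rw [e3]; exact mul_neg_of_neg_of_pos (by linarith) hlg
  have hnn := (h.good i2).1.1 g (h.sub _ hg)
  by_contra hc
  push Not at hc
  unfold seqC at hc
  rw [e2] at hneg
  exact absurd (mul_nonneg hc hnn) (not_le.2 hneg)

lemma Cfg.nonpos (h : Cfg S T) (ha0 : ∀ x ∈ S, 0 < a0 x) (hv : IsSeq (rkV T) n v) {m q : ℕ}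
    (hmq : m ≤ q) (hq : q ≤ n) (hneg : ∀ j, m ≤ j → j < q → seqC S T a0 v j < 0) :
    ∀ x ∈ T (v q), seqA S T a0 v m x ≤ 0 := by
  obtain ⟨t, rfl⟩ := Nat.exists_eq_add_of_le hmq
  induction t generalizing m with
  | zero => exact fun x hx => ((h.inv ha0 hv hq).1 x hx).le
  | succ t ih =>
    have eq1 : m + (t + 1) = m + 1 + t := by omega
    rw [eq1] at hq hneg ⊢
    have hm : m < m + 1 + t := by omega
    intro x hx
    have := ih (m := m + 1) (by omega) hq (fun j h1 h2 => hneg j (by omega) h2) x hx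
    have h1 := hneg m le_rfl hm
    have h2 := (h.good (h.inv ha0 hv (k := m) (by omega))).1.1 x (h.sub _ hx)
    simp only [seqA, LinearMap.sub_apply, LinearMap.smul_apply, smul_eq_mul] at this
    unfold seqC at h1
    nlinarith

lemma Cfg.lower (h : Cfg S T) (ha0 : ∀ x ∈ S, 0 < a0 x) (hv : IsSeq (rkV T) n v)
    (hw : IsSeq (rkV T) n w) {m q : ℕ}
    (hmq : m + 1 ≤ q) (hq : q ≤ n) (hneg : ∀ j, m + 1 ≤ j → j < q → seqC S T a0 v j < 0)
    (hvw : ∀ j ≤ m, v j = w j) (hne : v (m + 1) ≠ w (m + 1)) (hle : w (m + 1) ≤ v q) :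
    seqC S T a0 w m < seqC S T a0 v m := by
  have e := seqA_congr (S := S) (T := T) (a0 := a0) hvw
  refine lt_of_le_of_ne ?_ (h.seqC_ne ha0 hv hw (by omega) hvw hne).symm
  have i1 := h.inv ha0 hv (k := m) (by omega)
  have h1 := hv.1 m (by omega)
  have h3 := hw.1 (m + 1) (by omega)
  have em := hvw m le_rfl
  have l1 : v m < w (m + 1) := by rw [em]; exact hw.2 m (by omega)
  obtain ⟨g, hg, hga⟩ := h.exists_diff l1
  have hlg := Cfg.pos_of (h.good i1).1 (h.sub _ hg) hga
  have e1 := h.coef_spec i1 l1 (by omega) g hg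
  have e2 := h.nonpos ha0 hv hmq hq hneg g ((h.le_iff _ _).1 hle hg)
  simp only [seqA, LinearMap.sub_apply, LinearMap.smul_apply, smul_eq_mul] at e2
  unfold seqC
  rw [← e, ← em]
  rw [e1] at e2
  by_contra hc
  push Not at hc
  nlinarith

/-- lexicographic height -/
noncomputable def height (S : Set V) (T : L → Set V) (a0 : V →ₗ[ℝ] ℝ) (n : ℕ) (v : ℕ → L) :
    Lex (ℕ → ℝ) := toLex fun k => if k < n then seqC S T a0 v k else 0

lemma height_lt_of {k : ℕ} (hk : k < n) (hvw : ∀ j ≤ k, v j = w j)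
    (hlt : seqC S T a0 w k < seqC S T a0 v k) : height S T a0 n w < height S T a0 n v := by
  refine ⟨k, fun j hj => ?_, ?_⟩
  · change (if j < n then seqC S T a0 w j else 0) = (if j < n then seqC S T a0 v j else 0)
    rw [seqC_congr (fun i hi => (hvw i (by omega)).symm)]
  · change (if k < n then seqC S T a0 w k else 0) < (if k < n then seqC S T a0 v k else 0)
    simpa [hk] using hlt

lemma Cfg.height_lt (h : Cfg S T) (ha0 : ∀ x ∈ S, 0 < a0 x) (hv : IsSeq (rkV T) n v)
    (hw : IsSeq (rkV T) n w) {k : ℕ} (hk : k < n) (hvw : ∀ j ≤ k, v j = w j)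
    (hne : v (k + 1) ≠ w (k + 1)) (hlt : height S T a0 n w < height S T a0 n v) :
    seqC S T a0 w k < seqC S T a0 v k := by
  rcases lt_or_gt_of_ne (h.seqC_ne ha0 hv hw hk hvw hne) with h1 | h1
  · exact absurd (height_lt_of hk (fun j hj => (hvw j hj).symm) h1) (lt_asymm hlt)
  · exact h1

lemma Cfg.first_diff (h : Cfg S T) (hv : IsSeq (rkV T) n v) (hw : IsSeq (rkV T) n w)
    (hne : ∃ k ≤ n, v k ≠ w k) :
    ∃ m, m < n ∧ (∀ j ≤ m, v j = w j) ∧ v (m + 1) ≠ w (m + 1) := by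
  have h0 : v 0 = w 0 := h.inj (by
    rw [h.empty_of_rk (hv.1 0 (by omega)), h.empty_of_rk (hw.1 0 (by omega))])
  have hs := Nat.find_spec hne
  have hm := fun j => Nat.find_min (m := j) hne
  generalize Nat.find hne = k at hs hm
  cases k with
  | zero => exact absurd h0 hs.2
  | succ m =>
    refine ⟨m, hs.1, fun j hj => ?_, hs.2⟩
    by_contra hc
    exact hm j (by omega) ⟨by omega, hc⟩

/-- The Morse-type property of the lexicographic height on flags. -/
theorem Cfg.morse (h : Cfg S T) (hn : Module.finrank ℝ (Submodule.span ℝ S) = n) :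
    ∃ H : (ℕ → L) → Lex (ℕ → ℝ),
      (∀ v w, IsSeq (rkV T) n v → IsSeq (rkV T) n w → (∃ k ≤ n, v k ≠ w k) → H v ≠ H w) ∧
      ∀ v, IsSeq (rkV T) n v → ∀ J : Set ℕ,
        (∀ j ∈ J, 0 < j → j < n → ∃ u, IsSeq (rkV T) n u ∧ (∀ k ≤ n, k ≠ j → u k = v k) ∧
          u j ≠ v j ∧ H u < H v) →
        ∀ w, IsSeq (rkV T) n w → (∀ k ≤ n, k ∉ J → w k = v k) → (∃ k ≤ n, w k ≠ v k) →
          H w < H v := by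
  obtain ⟨a0, ha0⟩ := h.pos
  refine ⟨height S T a0 n, fun v w hv hw hne => ?_, fun v hv J hJ w hw hwv hne => ?_⟩
  · obtain ⟨m, hm, hvw, hne'⟩ := h.first_diff hv hw hne
    rcases lt_or_gt_of_ne (h.seqC_ne ha0 hv hw hm hvw hne') with h1 | h1
    · exact (height_lt_of hm (fun j hj => (hvw j hj).symm) h1).ne
    · exact (height_lt_of hm hvw h1).ne'
  · obtain ⟨m, hm, hvw, hne'⟩ := h.first_diff hv hw (by
      obtain ⟨k, hk, hk'⟩ := hne
      exact ⟨k, hk, fun h => hk' h.symm⟩)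
    apply height_lt_of hm hvw
    have htop : v n = w n := by
      obtain ⟨t, ht, ht'⟩ := h.top
      have e1 := h.eq_of_le_rk (ht' (v n)) (by rw [hv.1 n le_rfl]; omega)
      have e2 := h.eq_of_le_rk (ht' (w n)) (by rw [hw.1 n le_rfl]; omega)
      rw [e1, e2]
    have hmn : m + 1 < n := by
      rcases Nat.lt_or_ge (m + 1) n with h' | h'
      · exact h'
      · have : m + 1 = n := by omega
        rw [this] at hne'
        exact absurd htop hne'
    have hex : ∃ q, m + 1 < q ∧ (q = n ∨ q ∉ J) := ⟨n, hmn, Or.inl rfl⟩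
    have hs := Nat.find_spec hex
    have hmin := fun j => Nat.find_min (m := j) hex
    have hqn : Nat.find hex ≤ n := Nat.find_min' hex ⟨hmn, Or.inl rfl⟩
    generalize Nat.find hex = q at hs hmin hqn
    have hmJ : m + 1 ∈ J := by
      by_contra hc
      exact hne' (hwv (m + 1) hmn.le hc).symm
    have hjJ : ∀ j, m + 1 ≤ j → j < q → j ∈ J := by
      intro j h1 h2
      rcases h1.eq_or_lt with h3 | h3
      · exact h3 ▸ hmJ
      · by_contra hc
        exact hmin j h2 ⟨h3, Or.inr hc⟩
    have hqe : w q = v q := by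
      rcases hs.2 with h' | h'
      · rw [h']; exact htop.symm
      · exact hwv q hqn h'
    refine h.lower ha0 hv hw hs.1.le hqn (fun j h1 h2 => ?_) hvw hne' ?_
    · obtain ⟨u, hu, huv, hune, hult⟩ := hJ j (hjJ j h1 h2) (by omega) (by omega)
      obtain ⟨k, rfl⟩ : ∃ k, j = k + 1 := ⟨j - 1, by omega⟩
      refine h.neg ha0 hv hu (by omega) huv ?_
      exact h.height_lt ha0 hv hu (by omega) (fun i hi => (huv i (by omega) (by omega)).symm)
        (fun h => hune h.symm) hult
    · rw [← hqe]; exact hw.le hs.1.le hqn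

end Morse
end TwoOrb
set_option linter.unusedSectionVars false

namespace TwoOrb

section Hull
variable {d : ℕ}

/-- homogenisation -/
def hom (x : EucSp d) : EucSp d × ℝ := (x, 1)

lemma hom_inj : Function.Injective (hom (d := d)) := fun _ _ h => congrArg Prod.fst h

/-- homogenised vertex set of a face -/
def faceT (S0 : Finset (EucSp d)) {P : Set (EucSp d)} (F : Faces P) : Set (EucSp d × ℝ) :=
  hom '' ((S0 : Set (EucSp d)) ∩ F.1)

lemma face_hull {S0 : Finset (EucSp d)} {P F : Set (EucSp d)}
    (hP : P = convexHull ℝ (S0 : Set (EucSp d))) (hF : IsExposed ℝ P F) :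
    F = convexHull ℝ ((S0 : Set (EucSp d)) ∩ F) := by
  have hPc : IsCompact P := hP ▸ (S0.finite_toSet).isCompact_convexHull ℝ
  have hPconv : Convex ℝ P := hP ▸ convex_convexHull ℝ _
  have hFconv := hF.convex hPconv
  apply Set.Subset.antisymm
  · rw [← closure_convexHull_extremePoints (hF.isCompact hPc) hFconv]
    conv_rhs => rw [closure_convexHull_extremePoints (hF.isCompact hPc) hFconv]
    apply closure_minimal
    · apply convexHull_mono
      intro x hx
      refine ⟨?_, hx.1⟩
      have := hF.isExtreme.extremePoints_subset_extremePoints hx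
      rw [hP] at this
      exact extremePoints_convexHull_subset this
    · exact ((S0.finite_toSet.subset Set.inter_subset_left).isCompact_convexHull ℝ).isClosed
  · exact convexHull_min Set.inter_subset_right hFconv

lemma finrank_hom {A : Set (EucSp d)} (hA : A.Nonempty) :
    Module.finrank ℝ (Submodule.span ℝ (hom '' A)) = Module.finrank ℝ (vectorSpan ℝ A) + 1 := by
  obtain ⟨x0, hx0⟩ := hA
  have hinl : Function.Injective (LinearMap.inl ℝ (EucSp d) ℝ) := LinearMap.inl_injective
  have e1 : Submodule.span ℝ (hom '' A) =
      Submodule.span ℝ {hom x0} ⊔ (vectorSpan ℝ A).map (LinearMap.inl ℝ (EucSp d) ℝ) := by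
    apply le_antisymm
    · rw [Submodule.span_le]
      rintro _ ⟨x, hx, rfl⟩
      have : hom x = hom x0 + LinearMap.inl ℝ (EucSp d) ℝ (x -ᵥ x0) := by
        simp [hom]
      rw [this]
      exact Submodule.add_mem_sup (Submodule.mem_span_singleton_self _)
        (Submodule.mem_map_of_mem (vsub_mem_vectorSpan ℝ hx hx0))
    · refine sup_le ?_ ?_
      · rw [Submodule.span_singleton_le_iff_mem]
        exact Submodule.subset_span ⟨x0, hx0, rfl⟩
      · rw [vectorSpan_eq_span_vsub_set_right ℝ hx0, Submodule.map_span, Submodule.span_le]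
        rintro _ ⟨_, ⟨x, hx, rfl⟩, rfl⟩
        have : LinearMap.inl ℝ (EucSp d) ℝ (x -ᵥ x0) = hom x - hom x0 := by
          simp [hom]
        change LinearMap.inl ℝ (EucSp d) ℝ (x -ᵥ x0) ∈ _
        rw [this]
        exact Submodule.sub_mem _ (Submodule.subset_span ⟨x, hx, rfl⟩)
          (Submodule.subset_span ⟨x0, hx0, rfl⟩)
  have e2 : Submodule.span ℝ {hom x0} ⊓ (vectorSpan ℝ A).map (LinearMap.inl ℝ (EucSp d) ℝ) = ⊥ := by
    rw [eq_bot_iff]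
    rintro z ⟨hz1, hz2⟩
    obtain ⟨t, rfl⟩ := Submodule.mem_span_singleton.1 hz1
    obtain ⟨y, _, hy⟩ := hz2
    have := congrArg Prod.snd hy
    simp [hom] at this
    simp [← this]
  have e3 := Submodule.finrank_sup_add_finrank_inf_eq (Submodule.span ℝ {hom x0})
    ((vectorSpan ℝ A).map (LinearMap.inl ℝ (EucSp d) ℝ))
  rw [e2, ← e1, finrank_bot, finrank_span_singleton (by
    intro h
    have := congrArg Prod.snd h
    simp [hom] at this)] at e3
  have e4 := (Submodule.equivMapOfInjective _ hinl (vectorSpan ℝ A)).finrank_eq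
  omega

lemma faceT_rank {S0 : Finset (EucSp d)} {P : Set (EucSp d)}
    (hP : P = convexHull ℝ (S0 : Set (EucSp d))) (F : Faces P) :
    (rkV (faceT S0) F : ℤ) = faceRank F + 1 := by
  have hh := face_hull hP F.2
  unfold faceRank rkV faceT
  by_cases hF : F.1 = ∅
  · simp [hF]
  · rw [if_neg hF]
    have hne : ((S0 : Set (EucSp d)) ∩ F.1).Nonempty := by
      by_contra hc
      rw [Set.not_nonempty_iff_eq_empty] at hc
      rw [hc, convexHull_empty] at hh
      exact hF hh
    rw [finrank_hom hne, direction_affineSpan]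
    conv_rhs => rw [hh, ← direction_affineSpan, affineSpan_convexHull, direction_affineSpan]
    push_cast
    rfl

lemma faces_cfg {S0 : Finset (EucSp d)} {P : Set (EucSp d)}
    (hP : P = convexHull ℝ (S0 : Set (EucSp d))) :
    Cfg (L := Faces P) (hom '' (S0 : Set (EucSp d))) (faceT S0) where
  fin := S0.finite_toSet.image _
  pos := ⟨LinearMap.snd ℝ _ _, by rintro _ ⟨x, _, rfl⟩; simp [hom]⟩
  le_iff := by
    intro F G
    unfold faceT
    rw [Set.image_subset_image_iff hom_inj]
    constructor
    · intro h
      exact Set.inter_subset_inter_right _ h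
    · intro h
      change F.1 ⊆ G.1
      rw [face_hull hP F.2, face_hull hP G.2]
      exact convexHull_mono h
  exp := by
    intro F
    by_cases hF : F.1 = ∅
    · refine ⟨LinearMap.snd ℝ _ _, by rintro _ ⟨x, _, rfl⟩; simp [hom], fun x => ?_⟩
      simp only [faceT, hF, Set.inter_empty, Set.image_empty, Set.mem_empty_iff_false, false_iff]
      rintro ⟨⟨y, _, rfl⟩, h⟩
      simp [hom] at h
    · obtain ⟨x0, hx0⟩ := Set.nonempty_iff_ne_empty.2 hF
      obtain ⟨f, hf⟩ := F.2 ⟨x0, hx0⟩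
      have hx0' : x0 ∈ P ∧ ∀ y ∈ P, f y ≤ f x0 := by
        rw [hf] at hx0; exact hx0
      have hS : ∀ x ∈ S0, x ∈ P := fun x hx => hP ▸ subset_convexHull ℝ _ hx
      refine ⟨f x0 • LinearMap.snd ℝ (EucSp d) ℝ - f.toLinearMap ∘ₗ LinearMap.fst ℝ (EucSp d) ℝ,
        ?_, fun z => ⟨?_, ?_⟩⟩
      · rintro _ ⟨x, hx, rfl⟩
        simpa [hom] using hx0'.2 x (hS x hx)
      · rintro ⟨x, ⟨hx, hxF⟩, rfl⟩
        refine ⟨⟨x, hx, rfl⟩, ?_⟩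
        have hx' : x ∈ P ∧ ∀ y ∈ P, f y ≤ f x := by
          rw [hf] at hxF; exact hxF
        have := hx'.2 x0 hx0'.1
        have := hx0'.2 x hx'.1
        simp [hom]
        linarith
      · rintro ⟨⟨x, hx, rfl⟩, h0⟩
        refine ⟨x, ⟨hx, ?_⟩, rfl⟩
        simp [hom] at h0
        rw [hf]
        refine ⟨hS x hx, fun y hy => ?_⟩
        linarith [hx0'.2 y hy]
  surj := by
    intro l hl
    have hS : ∀ x ∈ S0, x ∈ P := fun x hx => hP ▸ subset_convexHull ℝ _ hx
    set g : EucSp d →ₗ[ℝ] ℝ := l ∘ₗ LinearMap.inl ℝ (EucSp d) ℝ with hg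
    have hlg : ∀ x, l (hom x) = g x + l (0, 1) := fun x => by
      rw [hg, LinearMap.comp_apply, ← map_add]
      congr 1
      simp [hom]
    by_cases hex : ∃ s ∈ S0, l (hom s) = 0
    · obtain ⟨s, hs, hls⟩ := hex
      have hpos : ∀ y ∈ P, 0 ≤ g y + l (0, 1) := by
        have hsub : P ⊆ {y | -l (0, 1) ≤ g y} := by
          rw [hP]
          refine convexHull_min ?_ ?_
          · intro x hx
            have := hl _ ⟨x, hx, rfl⟩
            rw [hlg] at this
            change -l (0, 1) ≤ g x
            linarith
          · exact convex_halfSpace_ge g.isLinear _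
        intro y hy
        have : -l (0, 1) ≤ g y := hsub hy
        linarith
      rw [hlg] at hls
      let G : StrongDual ℝ (EucSp d) := LinearMap.toContinuousLinearMap (-g)
      have hG : ∀ x, G x = - g x := fun x => rfl
      refine ⟨⟨G.toExposed P, ContinuousLinearMap.toExposed.isExposed⟩, hl, fun z => ⟨?_, ?_⟩⟩
      · rintro ⟨x, ⟨hx, hxF⟩, rfl⟩
        refine ⟨⟨x, hx, rfl⟩, ?_⟩
        have := hxF.2 s (hS s hs)
        rw [hG, hG] at this
        have := hpos x (hS x hx)
        rw [hlg]
        linarith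
      · rintro ⟨⟨x, hx, rfl⟩, h0⟩
        refine ⟨x, ⟨hx, hS x hx, fun y hy => ?_⟩, rfl⟩
        rw [hlg] at h0
        have := hpos y hy
        rw [hG, hG]
        linarith
    · push Not at hex
      refine ⟨⟨∅, isExposed_empty⟩, hl, fun z => ⟨?_, ?_⟩⟩
      · rintro ⟨x, ⟨hx, hxF⟩, rfl⟩
        exact absurd hxF (Set.notMem_empty x)
      · rintro ⟨⟨x, hx, rfl⟩, h0⟩
        exact absurd h0 (hex x hx)

lemma finrank_S {S0 : Finset (EucSp d)} {P : Set (EucSp d)}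
    (hP : P = convexHull ℝ (S0 : Set (EucSp d))) (hInter : (interior P).Nonempty) :
    Module.finrank ℝ (Submodule.span ℝ (hom '' (S0 : Set (EucSp d)))) = d + 1 := by
  have hne : (S0 : Set (EucSp d)).Nonempty := by
    by_contra hc
    rw [Set.not_nonempty_iff_eq_empty] at hc
    rw [hc, convexHull_empty] at hP
    rw [hP] at hInter
    simp at hInter
  rw [finrank_hom hne, ← direction_affineSpan]
  rw [hP, interior_convexHull_nonempty_iff_affineSpan_eq_top] at hInter
  rw [hInter, AffineSubspace.direction_top, finrank_top]
  simp

end Hull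
end TwoOrb
set_option linter.unusedSectionVars false

namespace TwoOrb

section PolyFlags
variable {L : Type*} [PartialOrder L]

/-- combinatorial data of the face lattice; ranks are shifted by one -/
structure Poly (rk : L → ℕ) (d : ℕ) : Prop where
  fin : Finite L
  smono : ∀ a b : L, a < b → rk a < rk b
  bot : ∃ b : L, rk b = 0 ∧ ∀ x, b ≤ x
  top : ∃ b : L, rk b = d + 1 ∧ ∀ x, x ≤ b
  dense : ∀ a b : L, a < b → rk a + 2 ≤ rk b → ∃ c, a < c ∧ c < b
  diamond : ∀ a b : L, a < b → rk b = rk a + 2 →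
    ∃ c c', c ≠ c' ∧ ∀ z, (a < z ∧ z < b) ↔ (z = c ∨ z = c')
  lat : ∀ (k : ℕ) (a b e e' : L), a ≠ b → rk a = k → rk b = k → rk e = k + 1 → rk e' = k + 1 →
    a ≤ e → b ≤ e → a ≤ e' → b ≤ e' → e = e'
  morse : ∃ H : (ℕ → L) → Lex (ℕ → ℝ),
    (∀ v w, IsSeq rk (d+1) v → IsSeq rk (d+1) w → (∃ k ≤ d+1, v k ≠ w k) → H v ≠ H w) ∧
    ∀ v, IsSeq rk (d+1) v → ∀ J : Set ℕ,
      (∀ j ∈ J, 0 < j → j < d+1 → ∃ u, IsSeq rk (d+1) u ∧ (∀ k ≤ d+1, k ≠ j → u k = v k) ∧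
        u j ≠ v j ∧ H u < H v) →
      ∀ w, IsSeq rk (d+1) w → (∀ k ≤ d+1, k ∉ J → w k = v k) → (∃ k ≤ d+1, w k ≠ v k) → H w < H v

variable {rk : L → ℕ} {d : ℕ}

namespace Poly

lemma mono (h : Poly rk d) {a b : L} (hab : a ≤ b) : rk a ≤ rk b := by
  rcases hab.lt_or_eq with h1 | h1
  · exact (h.smono _ _ h1).le
  · rw [h1]

lemma eq_of_le (h : Poly rk d) {a b : L} (hab : a ≤ b) (hr : rk b ≤ rk a) : a = b := by
  rcases hab.lt_or_eq with h1 | h1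
  · exact absurd (h.smono _ _ h1) (by omega)
  · exact h1

lemma le_top (h : Poly rk d) (a : L) : rk a ≤ d + 1 := by
  obtain ⟨t, ht, ht'⟩ := h.top
  rw [← ht]; exact h.mono (ht' a)

lemma flag_le (h : Poly rk d) (Φ : Flag L) {x y : L} (hx : x ∈ Φ) (hy : y ∈ Φ)
    (hr : rk x ≤ rk y) : x ≤ y := by
  rcases Φ.le_or_le hx hy with h1 | h1
  · exact h1
  · exact (h.eq_of_le h1 hr).symm.le

lemma exists_face (h : Poly rk d) (Φ : Flag L) (k : ℕ) (hk : k ≤ d + 1) :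
    ∃ x ∈ Φ, rk x = k := by
  have := h.fin
  by_contra hcon
  push Not at hcon
  obtain ⟨b, hb0, hb⟩ := h.bot
  obtain ⟨t, ht0, ht⟩ := h.top
  have hbΦ : b ∈ Φ := Flag.mem_iff_forall_le_or_ge.2 fun z _ => Or.inl (hb z)
  have htΦ : t ∈ Φ := Flag.mem_iff_forall_le_or_ge.2 fun z _ => Or.inr (ht z)
  obtain ⟨x, hx, hxm⟩ := Set.exists_max_image {x | x ∈ Φ ∧ rk x < k} rk (Set.toFinite _)
    ⟨b, hbΦ, by have := hcon b hbΦ; omega⟩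
  obtain ⟨y, hy, hym⟩ := Set.exists_min_image {x | x ∈ Φ ∧ k < rk x} rk (Set.toFinite _)
    ⟨t, htΦ, by have := hcon t htΦ; omega⟩
  have hxy : x < y := by
    refine lt_of_le_of_ne (h.flag_le Φ hx.1 hy.1 (by have := hx.2; have := hy.2; omega)) ?_
    rintro rfl
    have := hx.2; have := hy.2; omega
  obtain ⟨c, hc1, hc2⟩ := h.dense x y hxy (by have := hx.2; have := hy.2; omega)
  have hcΦ : c ∈ Φ := by
    refine Flag.mem_iff_forall_le_or_ge.2 fun z hz => ?_
    rcases lt_trichotomy (rk z) k with h1 | h1 | h1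
    · exact Or.inr ((h.flag_le Φ hz hx.1 (hxm z ⟨hz, h1⟩)).trans hc1.le)
    · exact absurd h1 (hcon z hz)
    · exact Or.inl (hc2.le.trans (h.flag_le Φ hy.1 hz (hym z ⟨hz, h1⟩)))
  have e1 := h.smono _ _ hc1
  have e2 := h.smono _ _ hc2
  rcases lt_trichotomy (rk c) k with h1 | h1 | h1
  · have := hxm c ⟨hcΦ, h1⟩; omega
  · exact hcon c hcΦ h1
  · have := hym c ⟨hcΦ, h1⟩; omega

/-- the face of (shifted) rank `k` of a flag -/
noncomputable def fc (h : Poly rk d) (Φ : Flag L) (k : ℕ) : L :=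
  (h.exists_face Φ (min k (d+1)) (min_le_right _ _)).choose

lemma fc_mem (h : Poly rk d) (Φ : Flag L) (k : ℕ) : h.fc Φ k ∈ Φ :=
  (h.exists_face Φ (min k (d+1)) (min_le_right _ _)).choose_spec.1

lemma fc_rk (h : Poly rk d) (Φ : Flag L) {k : ℕ} (hk : k ≤ d + 1) : rk (h.fc Φ k) = k :=
  (h.exists_face Φ (min k (d+1)) (min_le_right _ _)).choose_spec.2.trans (min_eq_left hk)

lemma eq_fc (h : Poly rk d) {Φ : Flag L} {x : L} (hx : x ∈ Φ) : h.fc Φ (rk x) = x := by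
  have h1 := h.fc_rk Φ (h.le_top x)
  exact h.eq_of_le (h.flag_le Φ (h.fc_mem _ _) hx h1.le) h1.ge

lemma mem_iff (h : Poly rk d) {Φ : Flag L} {x : L} : x ∈ Φ ↔ h.fc Φ (rk x) = x :=
  ⟨h.eq_fc, fun e => e ▸ h.fc_mem _ _⟩

lemma fc_seq (h : Poly rk d) (Φ : Flag L) : IsSeq rk (d+1) (h.fc Φ) := by
  refine ⟨fun k hk => h.fc_rk Φ hk, fun k hk => ?_⟩
  have h1 := h.fc_rk Φ hk.le
  have h2 := h.fc_rk Φ (k := k+1) hk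
  refine lt_of_le_of_ne (h.flag_le Φ (h.fc_mem _ _) (h.fc_mem _ _) (by omega)) ?_
  intro e
  rw [e] at h1
  omega

lemma ext_fc (h : Poly rk d) {Φ Ψ : Flag L} (e : ∀ k ≤ d+1, h.fc Φ k = h.fc Ψ k) : Φ = Ψ := by
  apply Flag.ext
  ext x
  simp only [Flag.mem_coe_iff, h.mem_iff]
  rw [e _ (h.le_top x)]

lemma seq_le (h : Poly rk d) {v : ℕ → L} (hv : IsSeq rk (d+1) v) {a b : ℕ} (hab : a ≤ b)
    (hb : b ≤ d + 1) : v a ≤ v b := by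
  induction b, hab using Nat.le_induction with
  | base => exact le_rfl
  | succ b hab ih => exact (ih (by omega)).trans (hv.2 b (by omega)).le

lemma exists_flag (h : Poly rk d) {v : ℕ → L} (hv : IsSeq rk (d+1) v) :
    ∃ Φ : Flag L, ∀ k ≤ d+1, h.fc Φ k = v k := by
  have hch : IsChain (· ≤ ·) {x | ∃ k ≤ d+1, v k = x} := by
    rintro x ⟨k, hk, rfl⟩ y ⟨l, hl, rfl⟩ _
    rcases le_total k l with e | e
    · exact Or.inl (h.seq_le hv e hl)
    · exact Or.inr (h.seq_le hv e hk)
  obtain ⟨Φ, hΦ⟩ := hch.exists_subset_flag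
  refine ⟨Φ, fun k hk => ?_⟩
  have := h.eq_fc (hΦ ⟨k, hk, rfl⟩ : v k ∈ Φ)
  rwa [hv.1 k hk] at this

/-- existence of adjacent flags -/
lemma exists_adj (h : Poly rk d) (Φ : Flag L) {i : ℕ} (hi : i < d) :
    ∃ Ψ : Flag L, h.fc Ψ (i+1) ≠ h.fc Φ (i+1) ∧ (∀ k ≤ d+1, k ≠ i+1 → h.fc Ψ k = h.fc Φ k) ∧
      ∀ Ω : Flag L, (∀ k ≤ d+1, k ≠ i+1 → h.fc Ω k = h.fc Φ k) → Ω = Φ ∨ Ω = Ψ := by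
  have hs := h.fc_seq Φ
  have l1 := hs.2 i (by omega)
  have l2 := hs.2 (i+1) (by omega)
  obtain ⟨c, c', hcc, hd'⟩ := h.diamond (h.fc Φ i) (h.fc Φ (i+2)) (l1.trans l2)
    (by rw [h.fc_rk Φ (by omega), h.fc_rk Φ (by omega)])
  have hm := (hd' _).1 ⟨l1, l2⟩
  obtain ⟨e, he1, he2⟩ : ∃ e, e ≠ h.fc Φ (i+1) ∧
      ∀ z, (h.fc Φ i < z ∧ z < h.fc Φ (i+2)) ↔ (z = h.fc Φ (i+1) ∨ z = e) := by
    rcases hm with hm | hm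
    · exact ⟨c', by rw [hm]; exact hcc.symm, by rw [hm]; exact hd'⟩
    · exact ⟨c, by rw [hm]; exact hcc, fun z => by rw [hm, hd' z, or_comm]⟩
  have hel := (he2 e).2 (Or.inr rfl)
  have her : rk e = i + 1 := by
    have a1 := h.smono _ _ hel.1
    have a2 := h.smono _ _ hel.2
    rw [h.fc_rk Φ (by omega)] at a1 a2
    omega
  have hseq : IsSeq rk (d+1) (Function.update (h.fc Φ) (i+1) e) := by
    constructor
    · intro k hk
      by_cases hki : k = i+1
      · subst hki; simpa using her
      · rw [Function.update_of_ne hki]; exact hs.1 k hk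
    · intro k hk
      by_cases hki : k = i+1
      · subst hki
        rw [Function.update_self, Function.update_of_ne (by omega)]
        exact hel.2
      · rw [Function.update_of_ne hki]
        by_cases hki2 : k = i
        · subst hki2
          rw [Function.update_self]; exact hel.1
        · rw [Function.update_of_ne (by omega)]
          exact hs.2 k hk
  obtain ⟨Ψ, hΨ⟩ := h.exists_flag hseq
  refine ⟨Ψ, ?_, ?_, ?_⟩
  · rw [hΨ _ (by omega), Function.update_self]; exact he1
  · intro k hk hki
    rw [hΨ k hk, Function.update_of_ne hki]
  · intro Ω hΩ
    have hso := h.fc_seq Ω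
    have q1 := hso.2 i (by omega)
    have q2 := hso.2 (i+1) (by omega)
    rw [hΩ i (by omega) (by omega)] at q1
    rw [hΩ (i+1+1) (by omega) (by omega)] at q2
    rcases (he2 _).1 ⟨q1, q2⟩ with e1 | e1
    · left
      apply h.ext_fc
      intro k hk
      by_cases hki : k = i+1
      · rw [hki, e1]
      · exact hΩ k hk hki
    · right
      apply h.ext_fc
      intro k hk
      rw [hΨ k hk]
      by_cases hki : k = i+1
      · rw [hki, e1, Function.update_self]
      · rw [Function.update_of_ne hki]
        exact hΩ k hk hki

/-- the `i`-adjacent flag -/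
noncomputable def r (h : Poly rk d) (i : ℕ) (Φ : Flag L) : Flag L :=
  if hi : i < d then (h.exists_adj Φ hi).choose else Φ

lemma r_ne_fc (h : Poly rk d) {i : ℕ} (hi : i < d) (Φ : Flag L) :
    h.fc (h.r i Φ) (i+1) ≠ h.fc Φ (i+1) := by
  rw [r, dif_pos hi]; exact (h.exists_adj Φ hi).choose_spec.1

lemma r_fc (h : Poly rk d) (i : ℕ) (Φ : Flag L) {k : ℕ} (hk : k ≤ d + 1) (hki : k ≠ i+1) :
    h.fc (h.r i Φ) k = h.fc Φ k := by
  by_cases hi : i < d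
  · rw [r, dif_pos hi]; exact (h.exists_adj Φ hi).choose_spec.2.1 k hk hki
  · rw [r, dif_neg hi]

lemma r_unique (h : Poly rk d) {i : ℕ} (hi : i < d) {Φ Ω : Flag L}
    (e : ∀ k ≤ d+1, k ≠ i+1 → h.fc Ω k = h.fc Φ k) : Ω = Φ ∨ Ω = h.r i Φ := by
  rw [r, dif_pos hi]; exact (h.exists_adj Φ hi).choose_spec.2.2 Ω e

lemma r_ne (h : Poly rk d) {i : ℕ} (hi : i < d) (Φ : Flag L) : h.r i Φ ≠ Φ :=
  fun e => h.r_ne_fc hi Φ (by rw [e])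

lemma r_invol (h : Poly rk d) (i : ℕ) (Φ : Flag L) : h.r i (h.r i Φ) = Φ := by
  by_cases hi : i < d
  · rcases h.r_unique hi (Φ := h.r i Φ) (Ω := Φ) (fun k hk hki => (h.r_fc i Φ hk hki).symm) with e | e
    · exact absurd e.symm (h.r_ne hi Φ)
    · exact e.symm
  · rw [r, dif_neg hi, r, dif_neg hi]

lemma r_comm (h : Poly rk d) {i j : ℕ} (hij : i + 2 ≤ j) (hj : j < d) (Φ : Flag L) :
    h.r i (h.r j Φ) = h.r j (h.r i Φ) := by
  have hi : i < d := by omega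
  -- the flag with rank `i+1` from `r i Φ` and rank `j+1` from `r j Φ`
  have hs := h.fc_seq Φ
  have s1 := h.fc_seq (h.r i Φ)
  have s2 := h.fc_seq (h.r j Φ)
  have hseq : IsSeq rk (d+1) (fun k => if k ≤ i+1 then h.fc (h.r i Φ) k else h.fc (h.r j Φ) k) := by
    constructor
    · intro k hk
      dsimp only
      split_ifs
      · exact s1.1 k hk
      · exact s2.1 k hk
    · intro k hk
      dsimp only
      by_cases c1 : k + 1 ≤ i + 1
      · rw [if_pos (by omega), if_pos c1]; exact s1.2 k hk
      · by_cases c2 : k ≤ i + 1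
        · have : k = i + 1 := by omega
          subst this
          rw [if_pos le_rfl, if_neg (by omega), h.r_fc j Φ (by omega) (by omega),
            ← h.r_fc i Φ (by omega) (by omega)]
          exact s1.2 _ hk
        · rw [if_neg c2, if_neg c1]; exact s2.2 k hk
  obtain ⟨Ψ, hΨ⟩ := h.exists_flag hseq
  have e1 : Ψ = h.r i (h.r j Φ) := by
    refine (h.r_unique hi (Φ := h.r j Φ) (Ω := Ψ) ?_).resolve_left ?_
    · intro k hk hki
      rw [hΨ k hk]
      split_ifs with c
      · rw [h.r_fc i Φ hk hki, h.r_fc j Φ hk (by omega)]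
      · rfl
    · intro e
      have := hΨ (i+1) (by omega)
      rw [e, if_pos le_rfl, h.r_fc j Φ (by omega) (by omega)] at this
      exact h.r_ne_fc hi Φ this.symm
  have e2 : Ψ = h.r j (h.r i Φ) := by
    refine (h.r_unique hj (Φ := h.r i Φ) (Ω := Ψ) ?_).resolve_left ?_
    · intro k hk hki
      rw [hΨ k hk]
      split_ifs with c
      · rfl
      · rw [h.r_fc i Φ hk (by omega), h.r_fc j Φ hk (by omega)]
    · intro e
      have := hΨ (j+1) (by omega)
      rw [e, if_neg (by omega), h.r_fc i Φ (by omega) (by omega)] at this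
      exact h.r_ne_fc hj Φ this.symm
  rw [← e1, e2]

lemma r_ne_r (h : Poly rk d) {i j : ℕ} (hij : i ≠ j) (hi : i < d) (Φ : Flag L) :
    h.r i Φ ≠ h.r j Φ := by
  intro e
  apply h.r_ne_fc hi Φ
  rw [e, h.r_fc j Φ (by omega) (by omega)]

/-- adjacent moves at consecutive ranks never commute -/
lemma r_not_comm (h : Poly rk d) {i : ℕ} (hi : i + 1 < d) (Φ : Flag L) :
    h.r i (h.r (i+1) Φ) ≠ h.r (i+1) (h.r i Φ) := by
  intro e
  have s0 := h.fc_seq Φ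
  have s1 := h.fc_seq (h.r i Φ)
  have s2 := h.fc_seq (h.r (i+1) Φ)
  have s3 := h.fc_seq (h.r (i+1) (h.r i Φ))
  have f1 : h.fc (h.r (i+1) (h.r i Φ)) (i+1) = h.fc (h.r i Φ) (i+1) :=
    h.r_fc _ _ (by omega) (by omega)
  have f2 : h.fc (h.r (i+1) (h.r i Φ)) (i+2) = h.fc (h.r (i+1) Φ) (i+2) := by
    rw [← e]; exact h.r_fc _ _ (by omega) (by omega)
  have f3 : h.fc (h.r i Φ) (i+2) = h.fc Φ (i+2) := h.r_fc _ _ (by omega) (by omega)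
  have f4 : h.fc (h.r (i+1) Φ) (i+1) = h.fc Φ (i+1) := h.r_fc _ _ (by omega) (by omega)
  refine h.r_ne_fc hi Φ (h.lat (i+1) (h.fc Φ (i+1)) (h.fc (h.r i Φ) (i+1)) _ _
    (h.r_ne_fc (by omega) Φ).symm (h.fc_rk _ (by omega)) (h.fc_rk _ (by omega))
    (h.fc_rk _ (by omega)) (h.fc_rk _ (by omega)) ?_ ?_ ?_ ?_)
  · rw [← f4]; exact (s2.2 (i+1) (by omega)).le
  · have := (s3.2 (i+1) (by omega)).le
    rw [f1] at this
    exact this.trans f2.le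
  · exact (s0.2 (i+1) (by omega)).le
  · rw [← f3]; exact (s1.2 (i+1) (by omega)).le

lemma rk_le_auto (h : Poly rk d) (e : L ≃o L) : ∀ (n : ℕ) (x : L), rk x = n → n ≤ rk (e x) := by
  intro n
  induction n with
  | zero => intro x _; omega
  | succ n ih =>
    intro x hx
    obtain ⟨Φ, hΦ⟩ := (Set.subsingleton_singleton (a := x)).isChain (r := (· ≤ ·)).exists_subset_flag
    have hxΦ : x ∈ Φ := hΦ rfl
    have hle := h.le_top x
    have h1 := (h.fc_seq Φ).2 n (by omega)
    have h2 := h.eq_fc hxΦ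
    rw [hx] at h2
    rw [h2] at h1
    have h3 := ih _ (h.fc_rk Φ (k := n) (by omega))
    have h4 := h.smono _ _ (e.lt_iff_lt.2 h1)
    omega

lemma rk_auto (h : Poly rk d) (e : L ≃o L) (x : L) : rk (e x) = rk x := by
  apply le_antisymm
  · have := h.rk_le_auto e.symm _ (e x) rfl
    simpa using this
  · exact h.rk_le_auto e _ x rfl

lemma mem_smul (e : L ≃o L) {Φ : Flag L} {x : L} (hx : x ∈ Φ) : e x ∈ e • Φ := by
  change e x ∈ ((e • Φ : Flag L) : Set L)
  rw [Flag.coe_smul]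
  exact Set.smul_mem_smul_set (a := e) hx

lemma fc_smul (h : Poly rk d) (e : L ≃o L) (Φ : Flag L) {k : ℕ} (hk : k ≤ d+1) :
    h.fc (e • Φ) k = e (h.fc Φ k) := by
  have := h.eq_fc (mem_smul e (h.fc_mem Φ k))
  rwa [h.rk_auto, h.fc_rk Φ hk] at this

lemma r_smul (h : Poly rk d) (e : L ≃o L) (Φ : Flag L) {i : ℕ} (hi : i < d) :
    h.r i (e • Φ) = e • h.r i Φ := by
  refine ((h.r_unique hi (Φ := e • Φ) (Ω := e • h.r i Φ) ?_).resolve_left ?_).symm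
  · intro k hk hki
    rw [h.fc_smul e _ hk, h.fc_smul e _ hk, h.r_fc i Φ hk hki]
  · intro hh
    exact h.r_ne hi Φ (smul_left_cancel e hh)

lemma finFlag (h : Poly rk d) : Finite (Flag L) := by
  have := h.fin
  exact Finite.of_injective (fun Φ : Flag L => (Φ : Set L)) SetLike.coe_injective

/-- Morse function on flags -/
lemma height (h : Poly rk d) : ∃ H : Flag L → Lex (ℕ → ℝ), Function.Injective H ∧
    ∀ (v : Flag L) (J : Set ℕ), (∀ j ∈ J, j < d → H (h.r j v) < H v) →
      ∀ w, (∀ k ≤ d+1, (∀ j ∈ J, k ≠ j+1) → h.fc w k = h.fc v k) → w ≠ v → H w < H v := by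
  obtain ⟨H, h1, h2⟩ := h.morse
  have key : ∀ v w : Flag L, v ≠ w → ∃ k ≤ d+1, h.fc v k ≠ h.fc w k := by
    intro v w hvw
    by_contra hc
    push Not at hc
    exact hvw (h.ext_fc hc)
  refine ⟨fun v => H (h.fc v), ?_, ?_⟩
  · intro v w hvw
    by_contra hne
    exact h1 _ _ (h.fc_seq v) (h.fc_seq w) (key v w hne) hvw
  · intro v J hJ w hw hne
    refine h2 _ (h.fc_seq v) {j | ∃ i ∈ J, j = i+1} ?_ _ (h.fc_seq w) ?_ (key _ _ hne)
    · rintro j ⟨i, hi, rfl⟩ _ hid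
      exact ⟨_, h.fc_seq (h.r i v), fun k hk hki => h.r_fc i v hk hki, h.r_ne_fc (by omega) v,
        hJ i hi (by omega)⟩
    · intro k hk hkJ
      refine hw k hk fun j hj hkj => hkJ ⟨j, hj, hkj⟩

/-- residues are transitive -/
lemma residue (h : Poly rk d) (J : Set ℕ) (O : Set (Flag L)) (v : Flag L) (hv : v ∈ O)
    (hO : ∀ j ∈ J, j < d → ∀ w ∈ O, h.r j w ∈ O)
    (w : Flag L) (hw : ∀ k ≤ d+1, (∀ j ∈ J, k ≠ j+1) → h.fc w k = h.fc v k) : w ∈ O := by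
  have := h.finFlag
  obtain ⟨H, hinj, hH⟩ := h.height
  by_contra hwO
  let R : Set (Flag L) := {w | ∀ k ≤ d+1, (∀ j ∈ J, k ≠ j+1) → h.fc w k = h.fc v k}
  have hR : ∀ j ∈ J, ∀ u ∈ R, h.r j u ∈ R := by
    intro j hj u hu k hk hkJ
    rw [h.r_fc j u hk (hkJ j hj)]; exact hu k hk hkJ
  have key : ∀ Q : Set (Flag L), (∀ j ∈ J, j < d → ∀ w ∈ Q, h.r j w ∈ Q) → Q ⊆ R → Q.Nonempty →
      ∃ u ∈ Q, ∀ z ∈ R, z ≠ u → H z < H u := by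
    intro Q hQ hQR hne
    obtain ⟨u, hu, hum⟩ := Set.exists_max_image Q H (Set.toFinite _) hne
    refine ⟨u, hu, fun z hz hzu => hH u J ?_ z ?_ hzu⟩
    · intro j hj hjd
      exact lt_of_le_of_ne (hum _ (hQ j hj hjd u hu)) (fun e => h.r_ne hjd u (hinj e))
    · intro k hk hkJ
      rw [hz k hk hkJ, hQR hu k hk hkJ]
  obtain ⟨u1, hu1, m1⟩ := key (O ∩ R) (fun j hj hjd w hw => ⟨hO j hj hjd w hw.1, hR j hj w hw.2⟩)
    Set.inter_subset_right ⟨v, hv, fun _ _ _ => rfl⟩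
  obtain ⟨u2, hu2, m2⟩ := key (R \ O) (fun j hj hjd w hw => ⟨hR j hj w hw.1, fun hc => hw.2 (by
      have := hO j hj hjd _ hc
      rwa [h.r_invol] at this)⟩) Set.sdiff_subset ⟨w, hw, hwO⟩
  have hne : u1 ≠ u2 := fun e => hu2.2 (e ▸ hu1.1)
  exact lt_asymm (m1 u2 hu2.1 hne.symm) (m2 u1 hu1.2 hne)

lemma connected (h : Poly rk d) (O : Set (Flag L)) (v : Flag L) (hv : v ∈ O)
    (hO : ∀ j < d, ∀ w ∈ O, h.r j w ∈ O) (w : Flag L) : w ∈ O := by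
  refine h.residue Set.univ O v hv (fun j _ hj => hO j hj) w ?_
  intro k hk hkJ
  rcases Nat.eq_zero_or_pos k with e | e
  · obtain ⟨b, hb0, hb⟩ := h.bot
    have hh : ∀ u : Flag L, h.fc u k = b := fun u =>
      (h.eq_of_le (hb _) (by rw [h.fc_rk u hk]; omega)).symm
    rw [hh, hh]
  · exact absurd (by omega) (hkJ (k-1) trivial)

/-- automorphisms fixing a flag are trivial -/
lemma rigid (h : Poly rk d) (e : L ≃o L) (v : Flag L) (he : e • v = v) : e = 1 := by
  have hall : ∀ w : Flag L, e • w = w := by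
    intro w
    refine h.connected {w | e • w = w} v he ?_ w
    intro j hj w hw
    change e • _ = _
    rw [← h.r_smul e w hj, hw]
  ext x
  obtain ⟨Φ, hΦ⟩ := (Set.subsingleton_singleton (a := x)).isChain (r := (· ≤ ·)).exists_subset_flag
  have hxΦ : x ∈ Φ := hΦ rfl
  have := h.fc_smul e Φ (h.le_top x)
  rw [hall, h.eq_fc hxΦ] at this
  exact this.symm

end Poly

/-- fixed point free involutions -/
lemma dihedral_ne {X : Type*} : ∀ (k : ℕ) (a b : X → X), (∀ x, a (a x) = x) → (∀ x, b (b x) = x) →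
    (∀ x, a x ≠ x) → (∀ x, b x ≠ x) → ∀ x, a ((b ∘ a)^[k] x) ≠ x := by
  intro k
  induction k with
  | zero => intro a b _ _ ha _ x; exact ha x
  | succ k ih =>
    intro a b ha hb ha' hb' x hx
    apply ih b a hb ha hb' ha' (a x)
    have h1 : ∀ k x, a ((b ∘ a)^[k] x) = (a ∘ b)^[k] (a x) := by
      intro k
      induction k with
      | zero => intro x; rfl
      | succ k ih => intro x; rw [Function.iterate_succ_apply, ih, Function.iterate_succ_apply]; rfl
    rw [← h1]
    have : (b ∘ a)^[k+1] x = a x := by rw [← ha ((b ∘ a)^[k+1] x), hx]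
    rw [Function.iterate_succ_apply'] at this
    exact this

namespace Poly

/-- number of faces of rank `i+2` in the section of `v` -/
noncomputable def pn (h : Poly rk d) (v : Flag L) (i : ℕ) : ℕ :=
  Nat.card {x : L | h.fc v i < x ∧ x < h.fc v (i+3) ∧ rk x = i+2}

lemma iter_fc (h : Poly rk d) (i j : ℕ) (v : Flag L) {k : ℕ} (hk : k ≤ d+1) (hi : k ≠ i+1)
    (hj : k ≠ j+1) (m : ℕ) : h.fc ((h.r j ∘ h.r i)^[m] v) k = h.fc v k := by
  induction m with
  | zero => rfl
  | succ m ih =>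
    rw [Function.iterate_succ_apply', Function.comp_apply, h.r_fc j _ hk hj, h.r_fc i _ hk hi, ih]

lemma period (h : Poly rk d) {i : ℕ} (hi : i + 1 < d) (v : Flag L) :
    Function.minimalPeriod (h.r (i+1) ∘ h.r i) v = h.pn v i := by
  have := h.finFlag
  set f := h.r (i+1) ∘ h.r i with hf
  have hinj : Function.Injective f := by
    apply Function.Injective.comp
    · exact (show Function.Involutive (h.r (i+1)) from h.r_invol _).injective
    · exact (show Function.Involutive (h.r i) from h.r_invol _).injective
  have hper : v ∈ Function.periodicPts f := Function.Injective.mem_periodicPts hinj v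
  set N := Function.minimalPeriod f v with hN
  have hNpos : 0 < N := Function.minimalPeriod_pos_of_mem_periodicPts hper
  have hNv : f^[N] v = v := Function.iterate_minimalPeriod
  have hdi : ∀ k x, h.r i (f^[k] x) ≠ x := fun k x =>
    dihedral_ne k _ _ (h.r_invol i) (h.r_invol (i+1)) (h.r_ne (by omega)) (h.r_ne hi) x
  have hdi2 : ∀ k l, f^[l] v ≠ h.r i (f^[k] v) := by
    intro k l e
    rcases le_total k l with c | c
    · obtain ⟨m, rfl⟩ := Nat.exists_eq_add_of_le c
      rw [add_comm, Function.iterate_add_apply] at e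
      have := congrArg (h.r i) e
      rw [h.r_invol] at this
      exact hdi _ _ this
    · obtain ⟨m, rfl⟩ := Nat.exists_eq_add_of_le c
      rw [add_comm, Function.iterate_add_apply] at e
      exact hdi _ _ e.symm
  have hseq := fun m => h.fc_seq (f^[m] v)
  have hbet : ∀ m, h.fc v i < h.fc (f^[m] v) (i+2) ∧ h.fc (f^[m] v) (i+2) < h.fc v (i+3) ∧
      rk (h.fc (f^[m] v) (i+2)) = i+2 := by
    intro m
    refine ⟨?_, ?_, h.fc_rk _ (by omega)⟩
    · rw [← h.iter_fc i (i+1) v (k := i) (by omega) (by omega) (by omega) m]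
      exact ((hseq m).2 i (by omega)).trans ((hseq m).2 (i+1) (by omega))
    · rw [← h.iter_fc i (i+1) v (k := i+3) (by omega) (by omega) (by omega) m]
      exact (hseq m).2 (i+2) (by omega)
  let g : Fin N → {x : L | h.fc v i < x ∧ x < h.fc v (i+3) ∧ rk x = i+2} :=
    fun m => ⟨h.fc (f^[m] v) (i+2), hbet m⟩
  have hg : Function.Bijective g := by
    constructor
    · intro a b hab
      have hab' : h.fc (f^[a] v) (i+2) = h.fc (f^[b] v) (i+2) := congrArg Subtype.val hab
      have : f^[a] v = f^[b] v := by
        refine (h.r_unique (i := i) (by omega) (Φ := f^[b] v) (Ω := f^[a] v) ?_).resolve_right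
          (hdi2 _ _)
        intro k hk hki
        by_cases c : k = i+2
        · rw [c, hab']
        · rw [h.iter_fc i (i+1) v hk hki c, h.iter_fc i (i+1) v hk hki c]
      have := (Function.iterate_eq_iterate_iff_of_lt_minimalPeriod a.2 b.2).1 this
      exact Fin.ext this
    · rintro ⟨x, hx1, hx2, hx3⟩
      -- a flag through x
      have hs := h.fc_seq v
      obtain ⟨y, hy1, hy2⟩ := h.dense _ _ hx1 (by rw [hx3, h.fc_rk v (by omega)])
      have hyr : rk y = i + 1 := by
        have a1 := h.smono _ _ hy1
        have a2 := h.smono _ _ hy2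
        rw [h.fc_rk v (by omega)] at a1
        omega
      have hsq : IsSeq rk (d+1) (fun k => if k = i+1 then y else if k = i+2 then x else h.fc v k) := by
        constructor
        · intro k hk
          dsimp only
          split_ifs with c1 c2
          · rw [c1, hyr]
          · rw [c2, hx3]
          · exact hs.1 k hk
        · intro k hk
          dsimp only
          by_cases c0 : k = i
          · subst c0
            rw [if_neg (by omega), if_neg (by omega), if_pos rfl]; exact hy1
          by_cases c1 : k = i+1
          · subst c1
            rw [if_pos rfl, if_neg (by omega), if_pos rfl]; exact hy2
          by_cases c2 : k = i+2
          · subst c2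
            rw [if_neg (by omega), if_pos rfl, if_neg (by omega), if_neg (by omega)]; exact hx2
          · rw [if_neg c1, if_neg c2, if_neg (by omega), if_neg (by omega)]
            exact hs.2 k hk
      obtain ⟨w, hw⟩ := h.exists_flag hsq
      have hwO := h.residue {i, i+1} {u | ∃ m < N, u = f^[m] v ∨ u = h.r i (f^[m] v)} v
        ⟨0, hNpos, Or.inl rfl⟩ ?_ w ?_
      · obtain ⟨m, hm, hm'⟩ := hwO
        refine ⟨⟨m, hm⟩, Subtype.ext ?_⟩
        change h.fc (f^[m] v) (i+2) = x
        have hwx := hw (i+2) (by omega)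
        rw [if_neg (by omega), if_pos rfl] at hwx
        rcases hm' with e | e
        · rw [← e, hwx]
        · rw [← hwx, e, h.r_fc i _ (by omega) (by omega)]
      · rintro j hj hjd u ⟨m, hm, hu⟩
        rcases hj with rfl | hj
        · rcases hu with rfl | rfl
          · exact ⟨m, hm, Or.inr rfl⟩
          · exact ⟨m, hm, Or.inl (h.r_invol _ _)⟩
        · rw [Set.mem_singleton_iff] at hj
          subst hj
          rcases hu with rfl | rfl
          · rcases Nat.eq_zero_or_pos m with e | e
            · refine ⟨N-1, by omega, Or.inr ?_⟩
              have : f^[N-1+1] v = v := by rw [Nat.sub_add_cancel hNpos]; exact hNv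
              rw [Function.iterate_succ_apply'] at this
              subst e
              change h.r (i+1) v = _
              conv_lhs => rw [← this]
              exact h.r_invol _ _
            · refine ⟨m-1, by omega, Or.inr ?_⟩
              obtain ⟨m', rfl⟩ : ∃ m', m = m'+1 := ⟨m-1, by omega⟩
              rw [Function.iterate_succ_apply', Nat.add_sub_cancel]
              exact h.r_invol _ _
          · by_cases c : m + 1 < N
            · refine ⟨m+1, c, Or.inl ?_⟩
              rw [Function.iterate_succ_apply']; rfl
            · refine ⟨0, hNpos, Or.inl ?_⟩
              have : m + 1 = N := by omega
              rw [← this, Function.iterate_succ_apply'] at hNv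
              exact hNv
      · intro k hk hkJ
        have k1 := hkJ i (by simp)
        have k2 := hkJ (i+1) (by simp)
        rw [hw k hk, if_neg k1, if_neg k2]
  have := Nat.card_congr (Equiv.ofBijective g hg)
  rw [Nat.card_eq_fintype_card, Fintype.card_fin] at this
  rw [pn, ← this]

lemma period_iff (h : Poly rk d) {i : ℕ} (hi : i + 1 < d) (v : Flag L) (m : ℕ) :
    (h.r (i+1) ∘ h.r i)^[m] v = v ↔ h.pn v i ∣ m := by
  rw [← h.period hi v]
  exact Function.isPeriodicPt_iff_minimalPeriod_dvd

lemma pn_smul (h : Poly rk d) {i : ℕ} (hi : i + 1 < d) (e : L ≃o L) (v : Flag L) :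
    h.pn (e • v) i = h.pn v i := by
  have hit : ∀ m, (h.r (i+1) ∘ h.r i)^[m] (e • v) = e • (h.r (i+1) ∘ h.r i)^[m] v := by
    intro m
    induction m with
    | zero => rfl
    | succ m ih =>
      rw [Function.iterate_succ_apply', Function.iterate_succ_apply', ih]
      simp only [Function.comp_apply]
      rw [h.r_smul e _ (by omega), h.r_smul e _ hi]
  have key : ∀ m, h.pn (e • v) i ∣ m ↔ h.pn v i ∣ m := by
    intro m
    rw [← h.period_iff hi, ← h.period_iff hi, hit, smul_left_cancel_iff]
  exact Nat.dvd_antisymm ((key _).2 dvd_rfl) ((key _).1 dvd_rfl)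

lemma pn_ne_one (h : Poly rk d) {i : ℕ} (hi : i + 1 < d) (v : Flag L) : h.pn v i ≠ 1 := by
  intro e
  have := (h.period_iff hi v 1).2 (by rw [e])
  have := congrArg (h.r (i+1)) this
  rw [Function.iterate_one, Function.comp_apply, h.r_invol] at this
  exact h.r_ne_r (by omega) (by omega) v this

lemma pn_ne_two (h : Poly rk d) {i : ℕ} (hi : i + 1 < d) (v : Flag L) : h.pn v i ≠ 2 := by
  intro e
  have := (h.period_iff hi v 2).2 (by rw [e])
  have := congrArg (fun x => h.r i (h.r (i+1) x)) this
  simp only [Function.iterate_succ_apply', Function.iterate_zero, id, Function.comp_apply,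
    h.r_invol] at this
  exact h.r_not_comm hi v this.symm

end Poly

end PolyFlags

end TwoOrb
set_option linter.unusedSectionVars false

namespace TwoOrb

section Developing
variable {X G α : Type*} [Group G] [Finite X] [LinearOrder α]

/-- lifted moves -/
def RR (r : ℕ → X → X) (lam : X → ℕ → G) (i : ℕ) (z : X × G) : X × G :=
  (r i z.1, z.2 * lam z.1 i)

lemma RR_invol {r : ℕ → X → X} {lam : X → ℕ → G} (hr : ∀ i x, r i (r i x) = x)
    {i : ℕ} (hinv : ∀ x, lam x i * lam (r i x) i = 1) (z : X × G) :
    RR r lam i (RR r lam i z) = z := by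
  unfold RR
  ext
  · exact hr i z.1
  · simp only
    rw [mul_assoc, hinv, mul_one]

lemma exists_dev (H : X → α) (hH : Function.Injective H) (d : ℕ) (r : ℕ → X → X) (lam : X → ℕ → G)
    (hr : ∀ i x, r i (r i x) = x) (hne : ∀ i < d, ∀ x, r i x ≠ x)
    (hinv : ∀ i < d, ∀ x, lam x i * lam (r i x) i = 1)
    (hlow : ∀ v i j, i < d → j < d → H (r i v) < H v → H (r j v) < H v →
      ∀ m, ((r j ∘ r i)^[m] v ≠ v → H ((r j ∘ r i)^[m] v) < H v) ∧
        H (r i ((r j ∘ r i)^[m] v)) < H v)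
    (hloop : ∀ i j, i < d → j < d → i ≠ j → ∀ v m, (r j ∘ r i)^[m] v = v →
      ∀ g : G, (RR r lam j ∘ RR r lam i)^[m] (v, g) = (v, g)) :
    ∃ D : X → G, ∀ v, ∀ i < d, D (r i v) = D v * lam v i := by
  have hwf : WellFounded (fun a b : X => H a < H b) := by
    have : IsTrans X (fun a b => H a < H b) := ⟨fun _ _ _ => lt_trans⟩
    have : Std.Irrefl (fun a b : X => H a < H b) := ⟨fun _ => lt_irrefl _⟩
    exact Finite.wellFounded_of_trans_of_irrefl _
  let D : X → G := hwf.fix (fun v rec =>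
    if hv : ∃ i, i < d ∧ H (r i v) < H v then
      rec (r hv.choose v) hv.choose_spec.2 * lam (r hv.choose v) hv.choose else 1)
  have hDeq : ∀ v, D v = if hv : ∃ i, i < d ∧ H (r i v) < H v then
      D (r hv.choose v) * lam (r hv.choose v) hv.choose else 1 := fun v => hwf.fix_eq _ v
  have main : ∀ v, ∀ i < d, H (r i v) < H v → D v = D (r i v) * lam (r i v) i := by
    intro v
    induction v using hwf.induction with
    | _ v ih =>
    intro i hi hiv
    have hex : ∃ i, i < d ∧ H (r i v) < H v := ⟨i, hi, hiv⟩
    have hDv := hDeq v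
    rw [dif_pos hex] at hDv
    obtain ⟨hj, hjv⟩ := hex.choose_spec
    generalize hex.choose = j at hDv hj hjv
    rw [hDv]
    by_cases hij : i = j
    · rw [hij]
    -- consistency below v
    have hstep : ∀ (l : ℕ), l < d → ∀ y, H y < H v → H (r l y) < H v →
        RR r lam l (y, D y) = (r l y, D (r l y)) := by
      intro l hl y hy hly
      unfold RR
      refine Prod.ext rfl ?_
      simp only
      rcases lt_trichotomy (H (r l y)) (H y) with c | c | c
      · rw [ih y hy l hl c]
        have := hinv l hl (r l y)
        rw [hr] at this
        rw [mul_assoc, this, mul_one]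
      · exact absurd (hH c) (hne l hl y)
      · have := ih (r l y) hly l hl (by rw [hr]; exact c)
        rw [this, hr]
    have hinj : Function.Injective (r j ∘ r i) :=
      (show Function.Involutive (r j) from hr j).injective.comp
        (show Function.Involutive (r i) from hr i).injective
    have hper : v ∈ Function.periodicPts (r j ∘ r i) := hinj.mem_periodicPts v
    set N := Function.minimalPeriod (r j ∘ r i) v with hN
    have hNpos : 0 < N := Function.minimalPeriod_pos_of_mem_periodicPts hper
    have hNv : (r j ∘ r i)^[N] v = v := Function.iterate_minimalPeriod
    have hlow' := hlow v i j hi hj hiv hjv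
    set g := D (r i v) * lam (r i v) i with hg
    have walk : ∀ k < N, RR r lam i ((RR r lam j ∘ RR r lam i)^[k] (v, g)) =
        (r i ((r j ∘ r i)^[k] v), D (r i ((r j ∘ r i)^[k] v))) := by
      intro k
      induction k with
      | zero =>
        intro _
        unfold RR
        refine Prod.ext rfl ?_
        simp only [Function.iterate_zero, id]
        have := hinv i hi (r i v)
        rw [hr] at this
        rw [hg, mul_assoc, this, mul_one]
      | succ k ihk =>
        intro hk
        rw [Function.iterate_succ_apply', Function.comp_apply, ihk (by omega)]
        have e1 : r j (r i ((r j ∘ r i)^[k] v)) = (r j ∘ r i)^[k+1] v := by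
          rw [Function.iterate_succ_apply']; rfl
        have hnev : (r j ∘ r i)^[k+1] v ≠ v := by
          intro e
          exact Function.not_isPeriodicPt_of_pos_of_lt_minimalPeriod (by omega) hk e
        have l2 := (hlow' (k+1)).1 hnev
        rw [hstep j hj _ (hlow' k).2 (by rw [e1]; exact l2), e1, hstep i hi _ l2 (hlow' (k+1)).2]
    have hw := walk (N-1) (by omega)
    have hl := hloop i j hi hj hij v N hNv g
    obtain ⟨N', hN'⟩ : ∃ N', N = N' + 1 := ⟨N-1, by omega⟩
    rw [hN', Nat.add_sub_cancel] at hw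
    rw [hN', Function.iterate_succ_apply', Function.comp_apply, hw] at hl
    have hlast : r i ((r j ∘ r i)^[N'] v) = r j v := by
      rw [hN', Function.iterate_succ_apply'] at hNv
      change r j (r i _) = v at hNv
      rw [← hNv, hr, hNv]
    rw [hlast] at hl
    exact congrArg Prod.snd hl
  refine ⟨D, fun v i hi => ?_⟩
  rcases lt_trichotomy (H (r i v)) (H v) with c | c | c
  · rw [main v i hi c]
    have := hinv i hi (r i v)
    rw [hr] at this
    rw [mul_assoc, this, mul_one]
  · exact absurd (hH c) (hne i hi v)
  · have := main (r i v) i hi (by rw [hr]; exact c)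
    rw [this, hr]

end Developing

section CoxE
variable {d : ℕ} {p : ℕ → ℕ} {q : ℕ}

lemma cox_self (i : ℕ) : coxEntry d p q i i = 1 := by simp [coxEntry]

lemma cox_symm (i j : ℕ) : coxEntry d p q i j = coxEntry d p q j i := by
  unfold coxEntry
  rw [max_comm, min_comm]
  simp only [eq_comm]

lemma cox_far {i j : ℕ} (hij : i + 2 ≤ j) (hj : j + 2 ≤ d) : coxEntry d p q i j = 2 := by
  unfold coxEntry
  rw [max_eq_right (by omega), min_eq_left (by omega), if_neg (by omega), if_neg (by omega),
    if_neg (by omega)]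

lemma cox_near {i : ℕ} (hi : i + 3 ≤ d) : coxEntry d p q i (i+1) = p (i+1) := by
  unfold coxEntry
  rw [max_eq_right (by omega), min_eq_left (by omega), if_neg (by omega), if_neg (by omega),
    if_pos rfl]

lemma cox_far' {i : ℕ} (hi : i + 4 ≤ d) : coxEntry d p q i (d-1) = 2 := by
  unfold coxEntry
  rw [max_eq_right (by omega), min_eq_left (by omega), if_neg (by omega), if_pos rfl,
    if_neg (by omega), if_neg (by omega)]

lemma cox_q (hd : 3 ≤ d) : coxEntry d p q (d-3) (d-1) = q := by
  unfold coxEntry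
  rw [max_eq_right (by omega), min_eq_left (by omega), if_neg (by omega), if_pos rfl,
    if_neg (by omega), if_pos rfl]

lemma cox_last (hd : 3 ≤ d) : coxEntry d p q (d-2) (d-1) = p (d-1) / 2 := by
  unfold coxEntry
  rw [max_eq_right (by omega), min_eq_left (by omega), if_neg (by omega), if_pos rfl, if_pos rfl]

end CoxE

end TwoOrb
set_option linter.unusedSectionVars false

namespace TwoOrb

section Group
variable {L : Type*} [PartialOrder L] {rk : L → ℕ} {d : ℕ}

/-- flags in the orbit of the base flag -/
def IsA (Φ v : Flag L) : Prop := ∃ e : L ≃o L, e • Φ = v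

/-- the situation of the theorem, in terms of shifted ranks -/
structure Setup (h : Poly rk d) (Φ : Flag L) (p : ℕ → ℕ) (q : ℕ) (γ : ℕ → L ≃o L) : Prop where
  hd : 3 ≤ d
  flip : ∀ v, IsA Φ (h.r (d-1) v) ↔ ¬ IsA Φ v
  same : ∀ v i, i + 1 < d → (IsA Φ (h.r i v) ↔ IsA Φ v)
  gam : ∀ i, i + 1 < d → γ i • Φ = h.r i Φ
  gam' : γ (d-1) • Φ = h.r (d-1) (h.r (d-2) (h.r (d-1) Φ))
  hp : ∀ i, i + 1 < d → p (i+1) = h.pn Φ i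
  hq : q = h.pn (h.r (d-1) Φ) (d-3)

namespace Setup
variable {h : Poly rk d} {Φ : Flag L} {p : ℕ → ℕ} {q : ℕ} {γ : ℕ → L ≃o L}

lemma base (_ : Setup h Φ p q γ) : IsA Φ Φ := ⟨1, one_smul _ _⟩

lemma smulA (_ : Setup h Φ p q γ) (e : L ≃o L) : IsA Φ (e • Φ) := ⟨e, rfl⟩

lemma pn_same (S : Setup h Φ p q γ) {i : ℕ} (hi : i + 1 < d) (v : Flag L)
    (hv : IsA Φ v ∨ i + 3 ≠ d) : h.pn v i = p (i+1) := by
  rw [S.hp i hi]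
  by_cases hA : IsA Φ v
  · obtain ⟨e, rfl⟩ := hA
    exact h.pn_smul hi e Φ
  · have hid := hv.resolve_left hA
    obtain ⟨e, he⟩ := (S.flip v).2 hA
    have : v = e • h.r (d-1) Φ := by
      rw [← h.r_smul e Φ (by have := S.hd; omega), he, h.r_invol]
    rw [this, h.pn_smul hi]
    unfold Poly.pn
    rw [h.r_fc (d-1) Φ (by omega) (by omega), h.r_fc (d-1) Φ (by omega) (by omega)]

lemma pn_q (S : Setup h Φ p q γ) (v : Flag L) (hA : ¬ IsA Φ v) : h.pn v (d-3) = q := by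
  have := S.hd
  obtain ⟨e, he⟩ := (S.flip v).2 hA
  have : v = e • h.r (d-1) Φ := by
    rw [← h.r_smul e Φ (by omega), he, h.r_invol]
  rw [this, h.pn_smul (by omega), S.hq]

lemma typ_iter (S : Setup h Φ p q γ) (v : Flag L) (m : ℕ) :
    IsA Φ ((h.r (d-1) ∘ h.r (d-2))^[m] v) ↔ (IsA Φ v ↔ Even m) := by
  have := S.hd
  induction m with
  | zero => simp
  | succ m ih =>
    rw [Function.iterate_succ_apply', Function.comp_apply, S.flip, S.same _ _ (by omega),
      Nat.even_add_one]
    tauto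

lemma even_of_fix (S : Setup h Φ p q γ) {v : Flag L} {m : ℕ}
    (hm : (h.r (d-1) ∘ h.r (d-2))^[m] v = v) : Even m := by
  have := S.typ_iter v m
  rw [hm] at this
  tauto

lemma last_iff (S : Setup h Φ p q γ) (v : Flag L) (m : ℕ) :
    (h.r (d-1) ∘ h.r (d-2))^[m] v = v ↔ p (d-1) ∣ m := by
  have := S.hd
  have h1 := h.period_iff (i := d-2) (by omega) v m
  rw [S.pn_same (by omega) v (Or.inr (by omega)), show d - 2 + 1 = d - 1 by omega] at h1
  exact h1

lemma even_p (S : Setup h Φ p q γ) : 2 ∣ p (d-1) :=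
  (S.even_of_fix ((S.last_iff Φ _).2 dvd_rfl)).two_dvd

lemma p_ne_one (S : Setup h Φ p q γ) {i : ℕ} (hi : i + 1 < d) : p (i+1) ≠ 1 := by
  rw [S.hp i hi]; exact h.pn_ne_one hi Φ

/-- the Coxeter matrix -/
noncomputable def mat (S : Setup h Φ p q γ) : CoxeterMatrix (Fin d) where
  M := fun i j => coxEntry d p q i j
  isSymm := by
    ext i j
    exact cox_symm _ _
  diagonal i := cox_self _
  off_diagonal := by
    have hd := S.hd
    have key : ∀ i j : ℕ, i < j → j < d → coxEntry d p q i j ≠ 1 := by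
      intro i j hij hj
      by_cases c1 : j = d - 1
      · subst c1
        by_cases c2 : i = d - 2
        · subst c2
          rw [cox_last hd]
          intro e
          have h1 := S.even_p
          have h2 : p (d-1) = 2 := by omega
          have h3 := S.hp (d-2) (by omega)
          rw [show d - 2 + 1 = d - 1 by omega, h2] at h3
          exact h.pn_ne_two (by omega) Φ h3.symm
        by_cases c3 : i = d - 3
        · subst c3
          rw [cox_q hd, S.hq]
          exact h.pn_ne_one (by omega) _
        · rw [cox_far' (by omega)]; omega
      · by_cases c2 : j = i + 1
        · subst c2
          rw [cox_near (by omega)]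
          exact S.p_ne_one (by omega)
        · rw [cox_far (by omega) (by omega)]; omega
    intro i j hij
    have hij' : (i : ℕ) ≠ j := fun e => hij (Fin.ext e)
    rcases lt_or_gt_of_ne hij' with c | c
    · exact key _ _ c j.2
    · intro e
      rw [cox_symm] at e
      exact key _ _ c i.2 e

/-- the moves realised by generators -/
noncomputable def gm (h : Poly rk d) (i : ℕ) (v : Flag L) : Flag L :=
  if i = d - 1 then h.r (d-1) (h.r (d-2) (h.r (d-1) v)) else h.r i v

lemma gm_smul (S : Setup h Φ p q γ) {i : ℕ} (hi : i < d) (e : L ≃o L) (v : Flag L) :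
    gm h i (e • v) = e • gm h i v := by
  have := S.hd
  unfold gm
  split_ifs
  · rw [h.r_smul e _ (by omega), h.r_smul e _ (by omega), h.r_smul e _ (by omega)]
  · rw [h.r_smul e _ hi]

lemma gam_gm (S : Setup h Φ p q γ) {i : ℕ} (hi : i < d) : γ i • Φ = gm h i Φ := by
  unfold gm
  split_ifs with c
  · subst c; exact S.gam'
  · exact S.gam i (by omega)

lemma pow_gm (S : Setup h Φ p q γ) {i j : ℕ} (hi : i < d) (hj : j < d) (m : ℕ) :
    (γ i * γ j)^m • Φ = (gm h j ∘ gm h i)^[m] Φ := by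
  induction m with
  | zero => simp
  | succ m ih =>
    rw [Function.iterate_succ_apply', Function.comp_apply, ← ih, pow_succ, mul_smul, mul_smul,
      S.gam_gm hj, S.gm_smul hi, ← S.gam_gm hi, ← S.gm_smul hj, ← S.gm_smul hj]

lemma gm_invol (h : Poly rk d) (i : ℕ) (v : Flag L) : gm h i (gm h i v) = v := by
  unfold gm
  split_ifs
  · simp only [h.r_invol]
  · exact h.r_invol _ _

lemma lift_lt (S : Setup h Φ p q γ) {i j : ℕ} (hij : i < j) (hj : j < d) :
    (γ i * γ j)^(coxEntry d p q i j) = 1 := by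
  have hd := S.hd
  apply h.rigid _ Φ
  rw [S.pow_gm (by omega) hj]
  by_cases c1 : j = d - 1
  · subst c1
    have hgi : gm h i = h.r i := by
      funext v; unfold gm; rw [if_neg (by omega)]
    have hgj : gm h (d-1) = h.r (d-1) ∘ h.r (d-2) ∘ h.r (d-1) := by
      funext v; unfold gm; rw [if_pos rfl]; rfl
    rw [hgi, hgj]
    by_cases c2 : i = d - 2
    · subst c2
      rw [cox_last hd]
      have e : (h.r (d-1) ∘ h.r (d-2) ∘ h.r (d-1)) ∘ h.r (d-2) = (h.r (d-1) ∘ h.r (d-2))^[2] := rfl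
      rw [e, ← Function.iterate_mul, S.last_iff, Nat.mul_div_cancel' S.even_p]
    by_cases c3 : i = d - 3
    · subst c3
      rw [cox_q hd]
      have e : ∀ m v, ((h.r (d-1) ∘ h.r (d-2) ∘ h.r (d-1)) ∘ h.r (d-3))^[m] v =
          h.r (d-1) ((h.r (d-2) ∘ h.r (d-3))^[m] (h.r (d-1) v)) := by
        intro m v
        induction m with
        | zero => exact (h.r_invol _ _).symm
        | succ m ih =>
          rw [Function.iterate_succ_apply', Function.iterate_succ_apply', ih]
          simp only [Function.comp_apply]
          rw [h.r_comm (i := d-3) (j := d-1) (by omega) (by omega), h.r_invol]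
      rw [e]
      have h1 := (h.period_iff (i := d-3) (by omega) (h.r (d-1) Φ) q).2 (by rw [← S.hq])
      rw [show d - 3 + 1 = d - 2 by omega] at h1
      rw [h1, h.r_invol]
    · rw [cox_far' (by omega)]
      simp only [Function.iterate_succ_apply', Function.iterate_zero, id, Function.comp_apply]
      rw [h.r_comm (i := i) (j := d-1) (by omega) (by omega),
        h.r_comm (i := i) (j := d-2) (by omega) (by omega),
        h.r_comm (i := i) (j := d-1) (by omega) (by omega)]
      simp only [h.r_invol]
  · have hgi : gm h i = h.r i := by
      funext v; unfold gm; rw [if_neg (by omega)]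
    have hgj : gm h j = h.r j := by
      funext v; unfold gm; rw [if_neg (by omega)]
    rw [hgi, hgj]
    by_cases c2 : j = i + 1
    · subst c2
      rw [cox_near (by omega), h.period_iff hj, S.hp i hj]
    · rw [cox_far (by omega) (by omega)]
      simp only [Function.iterate_succ_apply', Function.iterate_zero, id, Function.comp_apply]
      rw [h.r_comm (i := i) (j := j) (by omega) (by omega)]
      simp only [h.r_invol]

lemma gam_sq (S : Setup h Φ p q γ) {i : ℕ} (hi : i < d) : γ i * γ i = 1 := by
  apply h.rigid _ Φ
  have := S.pow_gm hi hi 1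
  rw [pow_one] at this
  rw [this]
  exact gm_invol h i Φ

lemma liftable (S : Setup h Φ p q γ) : S.mat.IsLiftable (fun i : Fin d => γ i) := by
  intro i j
  change (γ i * γ j)^(coxEntry d p q i j) = 1
  rcases lt_trichotomy (i : ℕ) j with c | c | c
  · exact S.lift_lt c j.2
  · rw [c, cox_self, pow_one]; exact S.gam_sq j.2
  · have h1 := S.lift_lt c i.2
    rw [cox_symm] at h1
    have hi : (γ i)⁻¹ = γ i := inv_eq_of_mul_eq_one_left (S.gam_sq i.2)
    have hj : (γ j)⁻¹ = γ j := inv_eq_of_mul_eq_one_left (S.gam_sq j.2)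
    have h2 := congrArg (·⁻¹) h1
    simp only [← inv_pow, mul_inv_rev, hi, hj, inv_one] at h2
    exact h2

section Dev
variable {G : Type*} [Group G]

/-- edge labels -/
noncomputable def lab (Φ : Flag L) (d : ℕ) (s : ℕ → G) (v : Flag L) (i : ℕ) : G :=
  if i = d - 1 then 1 else if i = d - 2 ∧ ¬ IsA Φ v then s (d-1) else s i

lemma lab_congr {s : ℕ → G} {v w : Flag L} (hvw : IsA Φ v ↔ IsA Φ w) (i : ℕ) :
    lab Φ d s v i = lab Φ d s w i := by
  unfold lab; rw [hvw]

lemma lab_inv (S : Setup h Φ p q γ) {s : ℕ → G}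
    (hs : ∀ i j, i < d → j < d → (s i * s j)^(coxEntry d p q i j) = 1)
    (i : ℕ) (hi : i < d) (v : Flag L) : lab Φ d s v i * lab Φ d s (h.r i v) i = 1 := by
  have hsq : ∀ i < d, s i * s i = 1 := fun i hi => by
    have := hs i i hi hi
    rwa [cox_self, pow_one] at this
  have := S.hd
  by_cases c : i = d - 1
  · unfold lab; rw [if_pos c, if_pos c, one_mul]
  · rw [lab_congr (S.same v i (by omega)) i]
    unfold lab
    rw [if_neg c]
    split_ifs
    · exact hsq _ (by omega)
    · exact hsq _ hi

lemma loop_lt (S : Setup h Φ p q γ) {s : ℕ → G}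
    (hs : ∀ i j, i < d → j < d → (s i * s j)^(coxEntry d p q i j) = 1)
    {i j : ℕ} (hij : i < j) (hj : j < d) (v : Flag L) (m : ℕ) (hm : (h.r j ∘ h.r i)^[m] v = v)
    (g : G) : (RR h.r (lab Φ d s) j ∘ RR h.r (lab Φ d s) i)^[m] (v, g) = (v, g) := by
  have hd := S.hd
  have hpow : ∀ {i j k : ℕ}, i < d → j < d → coxEntry d p q i j ∣ k → (s i * s j)^k = 1 := by
    rintro i j k hi hj ⟨c, rfl⟩
    rw [pow_mul, hs i j hi hj, one_pow]
  have hsq : ∀ i < d, s i * s i = 1 := fun i hi => by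
    have := hs i i hi hi
    rwa [cox_self, pow_one] at this
  -- m is even for commuting pairs
  have heven : i + 2 ≤ j → 2 ∣ m := by
    intro c
    rcases Nat.even_or_odd m with e | ⟨k, rfl⟩
    · exact e.two_dvd
    · exfalso
      have h2 : ∀ w, (h.r j ∘ h.r i)^[2] w = w := by
        intro w
        simp only [Function.iterate_succ_apply', Function.iterate_zero, id, Function.comp_apply]
        rw [h.r_comm c hj]
        simp only [h.r_invol]
      have h3 : ∀ k, (h.r j ∘ h.r i)^[2*k] v = v := by
        intro k
        rw [Function.iterate_mul]
        exact Function.iterate_fixed (h2 v) k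
      rw [show 2 * k + 1 = Nat.succ (2 * k) from rfl, Function.iterate_succ_apply', h3,
        Function.comp_apply] at hm
      have := congrArg (h.r j) hm
      rw [h.r_invol] at this
      exact h.r_ne_r (by omega) (by omega) v this
  by_cases c1 : j = d - 1
  · subst c1
    have hlj : ∀ w, lab Φ d s w (d-1) = 1 := fun w => by unfold lab; rw [if_pos rfl]
    by_cases c2 : i = d - 2
    · subst c2
      obtain ⟨k, rfl⟩ := (S.even_of_fix hm).two_dvd
      rw [S.last_iff] at hm
      have hk : coxEntry d p q (d-2) (d-1) ∣ k := by
        rw [cox_last hd]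
        obtain ⟨e, he⟩ := S.even_p
        rw [he] at hm ⊢
        rw [Nat.mul_div_cancel_left _ (by omega)]
        exact Nat.dvd_of_mul_dvd_mul_left (by omega) hm
      have hk' : coxEntry d p q (d-1) (d-2) ∣ k := by rwa [cox_symm]
      have hlA : ∀ w, IsA Φ w → lab Φ d s w (d-2) = s (d-2) := fun w hw => by
        unfold lab; rw [if_neg (by omega), if_neg (by tauto)]
      have hlB : ∀ w, ¬ IsA Φ w → lab Φ d s w (d-2) = s (d-1) := fun w hw => by
        unfold lab; rw [if_neg (by omega), if_pos ⟨rfl, hw⟩]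
      have hsame : ∀ w, IsA Φ (h.r (d-2) w) ↔ IsA Φ w := fun w => S.same w _ (by omega)
      rw [Function.iterate_mul]
      have step : ∀ k : ℕ, ((RR h.r (lab Φ d s) (d-1) ∘ RR h.r (lab Φ d s) (d-2))^[2])^[k] (v, g) =
          ((h.r (d-1) ∘ h.r (d-2))^[2*k] v,
            g * (if IsA Φ v then s (d-2) * s (d-1) else s (d-1) * s (d-2))^k) := by
        intro k
        induction k with
        | zero => simp
        | succ k ih =>
          rw [Function.iterate_succ_apply', ih]
          have hty := S.typ_iter v (2*k)
          have hev : Even (2*k) := even_two_mul k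
          generalize hw : (h.r (d-1) ∘ h.r (d-2))^[2*k] v = w at hty
          have hw2 : (h.r (d-1) ∘ h.r (d-2))^[2*(k+1)] v =
              h.r (d-1) (h.r (d-2) (h.r (d-1) (h.r (d-2) w))) := by
            rw [show 2*(k+1) = 2*k+1+1 by ring, Function.iterate_succ_apply',
              Function.iterate_succ_apply', hw]
            rfl
          rw [hw2]
          have hty' : IsA Φ w ↔ IsA Φ v := by tauto
          refine Prod.ext rfl ?_
          change g * _ ^ k * lab Φ d s w (d-2) * lab Φ d s _ (d-1) * lab Φ d s _ (d-2) *
            lab Φ d s _ (d-1) = _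
          rw [hlj, hlj, mul_one, mul_one]
          change g * _ ^ k * lab Φ d s w (d-2) * lab Φ d s (h.r (d-1) (h.r (d-2) w)) (d-2) = _
          have hf : IsA Φ (h.r (d-1) (h.r (d-2) w)) ↔ ¬ IsA Φ w := by rw [S.flip, hsame]
          by_cases hA : IsA Φ v
          · rw [if_pos hA, hlA w (hty'.2 hA), hlB _ (by tauto), pow_succ]
            simp only [mul_assoc]
          · rw [if_neg hA, hlB w (by tauto), hlA _ (by tauto), pow_succ]
            simp only [mul_assoc]
      rw [step, (S.last_iff v (2*k)).2 hm]
      refine Prod.ext rfl ?_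
      simp only
      split_ifs
      · rw [hpow (by omega) (by omega) hk, mul_one]
      · rw [hpow (by omega) (by omega) hk', mul_one]
    · obtain ⟨k, rfl⟩ := heven (by omega)
      have hli : ∀ w, lab Φ d s w i = s i := fun w => by
        unfold lab; rw [if_neg (by omega), if_neg (by omega)]
      rw [Function.iterate_mul]
      apply Function.iterate_fixed
      simp only [Function.iterate_succ_apply', Function.iterate_zero, id, Function.comp_apply]
      unfold RR
      simp only
      rw [hli, hli, hlj, hlj]
      refine Prod.ext ?_ ?_
      · simp only
        rw [h.r_comm (by omega) hj]
        simp only [h.r_invol]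
      · simp only [mul_one]
        rw [mul_assoc, hsq i (by omega), mul_one]
  · have hA : ∀ k, IsA Φ ((h.r j ∘ h.r i)^[k] v) ↔ IsA Φ v := by
      intro k
      induction k with
      | zero => rfl
      | succ k ih =>
        rw [Function.iterate_succ_apply', Function.comp_apply, S.same _ _ (by omega),
          S.same _ _ (by omega), ih]
    have walk : ∀ k, (RR h.r (lab Φ d s) j ∘ RR h.r (lab Φ d s) i)^[k] (v, g) =
        ((h.r j ∘ h.r i)^[k] v, g * (lab Φ d s v i * lab Φ d s v j)^k) := by
      intro k
      induction k with
      | zero => simp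
      | succ k ih =>
        rw [Function.iterate_succ_apply', Function.iterate_succ_apply', ih]
        refine Prod.ext rfl ?_
        change g * _ ^ k * lab Φ d s _ i * lab Φ d s (h.r i _) j = _
        rw [lab_congr (hA k) i, lab_congr ((S.same _ _ (by omega)).trans (hA k)) j, pow_succ]
        simp only [mul_assoc]
    rw [walk, hm]
    refine Prod.ext rfl ?_
    simp only
    have hli : lab Φ d s v i = s i := by
      unfold lab; rw [if_neg (by omega), if_neg (by omega)]
    rw [hli]
    suffices hsuf : (s i * lab Φ d s v j)^m = 1 by rw [hsuf, mul_one]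
    unfold lab
    rw [if_neg c1]
    split_ifs with c
    · obtain ⟨cj, hB⟩ := c
      apply hpow (by omega) (by omega)
      by_cases c2 : j = i + 1
      · have : i = d - 3 := by omega
        subst this
        rw [cox_q hd, ← S.pn_q v hB, ← h.period_iff (by omega), ← c2]
        exact hm
      · rw [cox_far' (by omega)]; exact heven (by omega)
    · apply hpow (by omega) (by omega)
      by_cases c2 : j = i + 1
      · subst c2
        rw [cox_near (by omega), ← S.pn_same hj v (by
          by_cases hv : IsA Φ v
          · exact Or.inl hv
          · right; intro e; exact c ⟨by omega, hv⟩), ← h.period_iff hj]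
        exact hm
      · rw [cox_far (by omega) (by omega)]; exact heven (by omega)

lemma loop (S : Setup h Φ p q γ) {s : ℕ → G}
    (hs : ∀ i j, i < d → j < d → (s i * s j)^(coxEntry d p q i j) = 1)
    (i j : ℕ) (hi : i < d) (hj : j < d) (hij : i ≠ j) (v : Flag L) (m : ℕ)
    (hm : (h.r j ∘ h.r i)^[m] v = v)
    (g : G) : (RR h.r (lab Φ d s) j ∘ RR h.r (lab Φ d s) i)^[m] (v, g) = (v, g) := by
  have := h.finFlag
  rcases lt_or_gt_of_ne hij with c | c
  · exact S.loop_lt hs c hj v m hm g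
  · have l1 : Function.LeftInverse (h.r i ∘ h.r j) (h.r j ∘ h.r i) := by
      intro w
      simp only [Function.comp_apply, h.r_invol]
    have l2 : Function.LeftInverse (RR h.r (lab Φ d s) j ∘ RR h.r (lab Φ d s) i)
        (RR h.r (lab Φ d s) i ∘ RR h.r (lab Φ d s) j) := by
      intro w
      simp only [Function.comp_apply]
      rw [RR_invol h.r_invol (S.lab_inv hs i hi), RR_invol h.r_invol (S.lab_inv hs j hj)]
    have hm' : (h.r i ∘ h.r j)^[m] v = v := by
      conv_lhs => rw [← hm]
      exact l1.iterate m v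
    have := S.loop_lt hs c hi v m hm' g
    conv_lhs => rw [← this]
    exact l2.iterate m (v, g)

lemma dev (S : Setup h Φ p q γ) {s : ℕ → G}
    (hs : ∀ i j, i < d → j < d → (s i * s j)^(coxEntry d p q i j) = 1) :
    ∃ D : Flag L → G, ∀ v, ∀ i < d, D (h.r i v) = D v * lab Φ d s v i := by
  have := h.finFlag
  obtain ⟨H, hinj, hH⟩ := h.height
  refine exists_dev H hinj d h.r (lab Φ d s) h.r_invol (fun i hi x => h.r_ne hi x)
    (S.lab_inv hs) ?_ (S.loop hs)
  intro v i j hi hj hiv hjv m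
  have key : ∀ w, (∀ k ≤ d+1, k ≠ i+1 → k ≠ j+1 → h.fc w k = h.fc v k) → w ≠ v → H w < H v := by
    intro w hw hne
    refine hH v {i, j} ?_ w ?_ hne
    · rintro l (rfl | hl) _
      · exact hiv
      · rw [Set.mem_singleton_iff] at hl; rw [hl]; exact hjv
    · intro k hk hkJ
      exact hw k hk (hkJ i (by simp)) (hkJ j (by simp))
  constructor
  · exact key _ fun k hk h1 h2 => h.iter_fc i j v hk h1 h2 m
  · apply key
    · intro k hk h1 h2
      rw [h.r_fc i _ hk h1, h.iter_fc i j v hk h1 h2 m]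
    · exact dihedral_ne m _ _ (h.r_invol i) (h.r_invol j) (h.r_ne hi) (h.r_ne hj) v

end Dev

theorem main (S : Setup h Φ p q γ) : ∃ cs : CoxeterSystem S.mat (L ≃o L),
    ∀ i : Fin d, cs.simple i = γ i := by
  have hd := S.hd
  let cs0 := S.mat.toCoxeterSystem
  let s : ℕ → S.mat.Group := fun i => if hi : i < d then cs0.simple ⟨i, hi⟩ else 1
  have hsi : ∀ i : Fin d, s i = cs0.simple i := fun i => dif_pos i.2
  have hs : ∀ i j, i < d → j < d → (s i * s j)^(coxEntry d p q i j) = 1 := by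
    intro i j hi hj
    have := cs0.simple_mul_simple_pow ⟨i, hi⟩ ⟨j, hj⟩
    rw [← hsi, ← hsi] at this
    exact this
  obtain ⟨D, hD⟩ := S.dev hs
  let ρ := cs0.lift ⟨fun i : Fin d => γ i, S.liftable⟩
  have hρ : ∀ i : Fin d, ρ (cs0.simple i) = γ i := fun i => cs0.lift_apply_simple S.liftable i
  have hDg : ∀ v, IsA Φ v → ∀ i < d, D (gm h i v) = D v * s i := by
    intro v hv i hi
    unfold gm
    split_ifs with c
    · rw [hD _ _ (by omega), hD _ _ (by omega), hD _ _ (by omega)]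
      have e1 : ∀ w, lab Φ d s w (d-1) = 1 := fun w => if_pos rfl
      have e2 : lab Φ d s (h.r (d-1) v) (d-2) = s (d-1) := by
        unfold lab
        rw [if_neg (by omega), if_pos ⟨rfl, by rw [S.flip]; tauto⟩]
      rw [e1, e1, e2, c, mul_one, mul_one]
    · rw [hD _ _ hi]
      unfold lab
      rw [if_neg c, if_neg (by tauto)]
  have hstep : ∀ (w : S.mat.Group) (i : Fin d), ρ (w * cs0.simple i) • Φ = gm h i (ρ w • Φ) := by
    intro w i
    rw [map_mul, hρ, mul_smul, S.gam_gm i.2, S.gm_smul i.2]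
  have hDρ : ∀ w : S.mat.Group, D (ρ w • Φ) = D Φ * w := by
    intro w
    induction w using cs0.simple_induction_right with
    | one => rw [map_one, one_smul, mul_one]
    | mul_simple_right w i ih =>
      rw [hstep, hDg _ (S.smulA _) i i.2, ih, hsi, mul_assoc]
  have hinj : Function.Injective ρ := by
    rw [injective_iff_map_eq_one]
    intro w hw
    have := hDρ w
    rw [hw, one_smul] at this
    exact (mul_eq_left.1 this.symm)
  have hsurj : Function.Surjective ρ := by
    intro e
    have hmem := h.connected {v | ∃ w, v = ρ w • Φ ∨ v = h.r (d-1) (ρ w • Φ)} Φ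
      ⟨1, Or.inl (by rw [map_one, one_smul])⟩ ?_ (e • Φ)
    · obtain ⟨w, hw | hw⟩ := hmem
      · refine ⟨w, ?_⟩
        have : e⁻¹ * ρ w = 1 := by
          apply h.rigid _ Φ
          rw [mul_smul, ← hw, inv_smul_smul]
        exact (inv_mul_eq_one.1 this).symm
      · exfalso
        have h1 := S.smulA e
        rw [hw, S.flip] at h1
        exact h1 (S.smulA _)
    · rintro j hj v ⟨w, rfl | rfl⟩
      · by_cases c : j = d - 1
        · subst c; exact ⟨w, Or.inr rfl⟩
        · refine ⟨w * cs0.simple ⟨j, hj⟩, Or.inl ?_⟩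
          rw [hstep]
          unfold gm
          rw [if_neg c]
      · by_cases c : j = d - 1
        · subst c; exact ⟨w, Or.inl (h.r_invol _ _)⟩
        by_cases c2 : j = d - 2
        · refine ⟨w * cs0.simple ⟨d-1, by omega⟩, Or.inr ?_⟩
          rw [hstep, c2]
          unfold gm
          rw [if_pos rfl, h.r_invol]
        · refine ⟨w * cs0.simple ⟨j, hj⟩, Or.inr ?_⟩
          rw [hstep]
          unfold gm
          rw [if_neg c, h.r_comm (by omega) (by omega)]
  refine ⟨cs0.map (MulEquiv.ofBijective ρ ⟨hinj, hsurj⟩), fun i => ?_⟩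
  rw [CoxeterSystem.map_simple]
  exact hρ i

end Setup
end Group

end TwoOrb
namespace TwoOrb

section Final
variable {L : Type*} [PartialOrder L]

lemma smul_flag_iff (e : L ≃o L) (v w : Flag L) : e • v = w ↔ e '' (v : Set L) = (w : Set L) := by
  constructor
  · rintro rfl; rfl
  · intro hh; exact Flag.ext hh

lemma sfo_iff (v w : Flag L) : SameFlagOrbit v w ↔ ∃ e : L ≃o L, e • v = w := by
  unfold SameFlagOrbit
  simp only [smul_flag_iff]

lemma sfo_symm {v w : Flag L} (hvw : SameFlagOrbit v w) : SameFlagOrbit w v := by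
  rw [sfo_iff] at *
  obtain ⟨e, rfl⟩ := hvw
  exact ⟨e⁻¹, inv_smul_smul _ _⟩

lemma sfo_trans {u v w : Flag L} (h1 : SameFlagOrbit u v) (h2 : SameFlagOrbit v w) :
    SameFlagOrbit u w := by
  rw [sfo_iff] at *
  obtain ⟨e, rfl⟩ := h1
  obtain ⟨e', rfl⟩ := h2
  exact ⟨e' * e, mul_smul _ _ _⟩

lemma adj_iff {rk : L → ℕ} {d : ℕ} (h : Poly rk d) (rz : L → ℤ) (hz : ∀ x, (rk x : ℤ) = rz x + 1)
    {i : ℕ} (hi : i < d) (v w : Flag L) : IsIAdjacent rz i v w ↔ w = h.r i v := by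
  constructor
  · rintro ⟨hne, hx⟩
    refine (h.r_unique hi (Φ := v) (Ω := w) ?_).resolve_left hne.symm
    intro k hk hki
    have hr := h.fc_rk v hk
    have hz' := hz (h.fc v k)
    have hmem := (hx (h.fc v k) (by rw [hr] at hz'; omega)).1 (h.fc_mem v k)
    have := h.eq_fc hmem
    rwa [hr] at this
  · rintro rfl
    refine ⟨(h.r_ne hi v).symm, fun x hx => ?_⟩
    rw [h.mem_iff, h.mem_iff, h.r_fc i v (h.le_top x) (by have := hz x; omega)]

end Final

end TwoOrb

/-- Let `P` be a combinatorially two-orbit convex `d`-polytope (`d ≥ 3`) of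
class `2_{{0,…,d-2}}`, with base flag `Φ = {F₋₁, F₀, …, F_d}`, distinguished automorphisms
`γ₀, …, γ_{d-2}, γ'` (where `γᵢ(Φ) = Φ^i` and `γ'(Φ) = ((Φ^{d-1})^{d-2})^{d-1}`), Schläfli
numbers `pᵢ` (the number of rank-`i` faces strictly between `F_{i-2}` and `F_{i+1}`) and `q`
(the number of rank-`(d-2)` faces strictly between `F_{d-4}` and the facet `F'_{d-1}` of
`Φ^{d-1}`). Then `p_{d-1}` is even, and `Γ(P)` together with these generators is a Coxeter
system whose Coxeter matrix is given by: `M(γᵢ,γᵢ) = M(γ',γ') = 1`; `M(γ_{i-1},γᵢ) = pᵢ`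
for `1 ≤ i ≤ d-2`; `M(γᵢ,γ_k) = 2` for `k - i ≥ 2` with `i, k ≤ d-2`; `M(γ',γᵢ) = 2` for
`i ≤ d-4`; `M(γ',γ_{d-3}) = q`; and `M(γ',γ_{d-2}) = p_{d-1}/2`. -/
theorem automorphism_group_is_coxeter {d : ℕ} (hd : 3 ≤ d)
    (P : Set (EucSp d)) (hP : IsConvexPolytope P)
    (h2 : InClass (faceRank (P := P)) d (Set.Iio (d - 1)))
    (Φ : Flag (Faces P))
    (F : ℤ → Faces P)
    (hF : ∀ i : ℤ, -1 ≤ i → i ≤ d → F i ∈ Φ ∧ faceRank (F i) = i)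
    (Ψ : ℕ → Flag (Faces P))
    (hΨ : ∀ i : ℕ, i < d → IsIAdjacent faceRank i Φ (Ψ i))
    (F' : Faces P) (hF' : F' ∈ Ψ (d - 1) ∧ faceRank F' = (d : ℤ) - 1)
    (Ω₁ Ω₂ : Flag (Faces P))
    (hΩ₁ : IsIAdjacent faceRank ((d : ℤ) - 2) (Ψ (d - 1)) Ω₁)
    (hΩ₂ : IsIAdjacent faceRank ((d : ℤ) - 1) Ω₁ Ω₂)
    (γ : ℕ → Faces P ≃o Faces P)
    (hγ : ∀ i : ℕ, i ≤ d - 2 → γ i '' (Φ : Set (Faces P)) = (Ψ i : Set (Faces P)))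
    (γ' : Faces P ≃o Faces P) (hγ' : γ' '' (Φ : Set (Faces P)) = (Ω₂ : Set (Faces P)))
    (p : ℕ → ℕ)
    (hp : ∀ i : ℕ, 1 ≤ i → i ≤ d - 1 →
      p i = Nat.card {x : Faces P | F ((i : ℤ) - 2) < x ∧ x < F ((i : ℤ) + 1) ∧
        faceRank x = (i : ℤ)})
    (q : ℕ)
    (hq : q = Nat.card {x : Faces P | F ((d : ℤ) - 4) < x ∧ x < F' ∧
        faceRank x = (d : ℤ) - 2}) :
    2 ∣ p (d - 1) ∧
    ∃ M : CoxeterMatrix (Fin d),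
      (∀ i j : Fin d, M.M i j = coxEntry d p q i j) ∧
      ∃ cs : CoxeterSystem M (Faces P ≃o Faces P),
        ∀ i : Fin d, cs.simple i = if (i : ℕ) = d - 1 then γ' else γ i := by
  obtain ⟨⟨S0, hPS⟩, hInter⟩ := hP
  have C := TwoOrb.faces_cfg hPS
  have hn := TwoOrb.finrank_S hPS hInter
  let rk : Faces P → ℕ := TwoOrb.rkV (TwoOrb.faceT S0)
  have hz : ∀ x : Faces P, (rk x : ℤ) = faceRank x + 1 := fun x => TwoOrb.faceT_rank hPS x
  have h : TwoOrb.Poly rk d :=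
    { fin := C.finite
      smono := fun a b hab => C.smono hab
      bot := C.bot
      top := by rw [← hn]; exact C.top
      dense := fun a b hab hr => C.dense hab hr
      diamond := fun a b hab hr => C.diamond hab hr
      lat := fun k a b e e' h1 h2 h3 h4 h5 h6 h7 h8 h9 => C.lat h1 h2 h3 h4 h5 h6 h7 h8 h9
      morse := C.morse hn }
  have hadj := fun {i : ℕ} (hi : i < d) v w => TwoOrb.adj_iff h faceRank hz hi v w
  have hA : ∀ v, TwoOrb.IsA Φ v ↔ SameFlagOrbit Φ v := fun v => (TwoOrb.sfo_iff Φ v).symm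
  have hΨ' : ∀ i < d, Ψ i = h.r i Φ := fun i hi => (hadj hi _ _).1 (hΨ i hi)
  have hΩ₁' : Ω₁ = h.r (d-2) (h.r (d-1) Φ) := by
    rw [← hΨ' (d-1) (by omega)]
    refine (hadj (by omega) _ _).1 ?_
    rw [show ((d - 2 : ℕ) : ℤ) = (d : ℤ) - 2 by omega]
    exact hΩ₁
  have hΩ₂' : Ω₂ = h.r (d-1) (h.r (d-2) (h.r (d-1) Φ)) := by
    rw [← hΩ₁']
    refine (hadj (by omega) _ _).1 ?_
    rw [show ((d - 1 : ℕ) : ℤ) = (d : ℤ) - 1 by omega]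
    exact hΩ₂
  have hFfc : ∀ k : ℕ, k ≤ d + 1 → F ((k : ℤ) - 1) = h.fc Φ k := by
    intro k hk
    obtain ⟨h1, h3⟩ := hF ((k : ℤ) - 1) (by omega) (by omega)
    have h4 := hz (F ((k : ℤ) - 1))
    have h5 : rk (F ((k : ℤ) - 1)) = k := by omega
    have := h.eq_fc h1
    rw [h5] at this
    exact this.symm
  have hF'fc : F' = h.fc (h.r (d-1) Φ) d := by
    obtain ⟨h1, h3⟩ := hF'
    rw [hΨ' (d-1) (by omega)] at h1
    have h4 := hz F'
    have h5 : rk F' = d := by omega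
    have := h.eq_fc h1
    rw [h5] at this
    exact this.symm
  have S : TwoOrb.Setup h Φ p q (fun i => if i = d - 1 then γ' else γ i) :=
    { hd := hd
      flip := by
        intro v
        rw [hA, hA]
        have hnot : ¬ SameFlagOrbit v (h.r (d-1) v) := by
          intro hc
          have := (h2.2 v (h.r (d-1) v) (d-1) (by omega) ((hadj (by omega) _ _).2 rfl)).1 hc
          exact lt_irrefl _ (Set.mem_Iio.1 this)
        constructor
        · intro h1 h3
          exact hnot (TwoOrb.sfo_trans (TwoOrb.sfo_symm h3) h1)
        · intro h1
          obtain ⟨a, b, -, hab⟩ := h2.1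
          have key : ∀ {x y c : Flag (Faces P)}, SameFlagOrbit x c → SameFlagOrbit y c →
              SameFlagOrbit x y := fun hx hy => TwoOrb.sfo_trans hx (TwoOrb.sfo_symm hy)
          rcases hab Φ with e1 | e1 <;> rcases hab v with e2 | e2 <;>
            rcases hab (h.r (d-1) v) with e3 | e3 <;>
            first
              | exact key e1 e3
              | exact absurd (key e1 e2) h1
              | exact absurd (key e2 e3) hnot
      same := by
        intro v i hi
        rw [hA, hA]
        have hs : SameFlagOrbit v (h.r i v) :=
          (h2.2 v (h.r i v) i (by omega) ((hadj (by omega) _ _).2 rfl)).2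
            (by simp only [Set.mem_Iio]; omega)
        exact ⟨fun hc => TwoOrb.sfo_trans hc (TwoOrb.sfo_symm hs), fun hc => TwoOrb.sfo_trans hc hs⟩
      gam := by
        intro i hi
        rw [if_neg (by omega), TwoOrb.smul_flag_iff, ← hΨ' i (by omega)]
        exact hγ i (by omega)
      gam' := by
        rw [if_pos rfl, TwoOrb.smul_flag_iff, ← hΩ₂']
        exact hγ'
      hp := by
        intro i hi
        rw [hp (i+1) (by omega) (by omega), TwoOrb.Poly.pn, ← hFfc i (by omega),
          ← hFfc (i+3) (by omega)]
        have e1 : ((i + 1 : ℕ) : ℤ) - 2 = (i : ℤ) - 1 := by push_cast; ring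
        have e2 : ((i + 1 : ℕ) : ℤ) + 1 = ((i + 3 : ℕ) : ℤ) - 1 := by push_cast; ring
        rw [e1, e2]
        congr! 6 with x
        have := hz x
        omega
      hq := by
        rw [hq, TwoOrb.Poly.pn, h.r_fc (d-1) Φ (k := d-3) (by omega) (by omega),
          ← hFfc (d-3) (by omega), show d - 3 + 3 = d by omega, ← hF'fc]
        have e1 : ((d - 3 : ℕ) : ℤ) - 1 = (d : ℤ) - 4 := by omega
        rw [e1]
        congr! 6 with x
        have := hz x
        omega }
  refine ⟨S.even_p, S.mat, fun i j => rfl, ?_⟩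
  exact S.main
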